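/- arXiv:math/0508282 — 7 statements merged into one kernel-verified Lean document; each statement's English description precedes it below -/
import Mathlib

section
/- Suppose X ∈ ℝ^p and Z ∈ ℝ^n have joint density (∏_{i=1}^p d_i^{-1/2}) σ^{-p-n} f(((x−θ)ᵀD^{-1}(x−θ) + zᵀz)/σ²), and let θ̂_φ = (I − (S/(XᵀC^{-1}D^{-1}X)) φ(XᵀC^{-1}D^{-1}X/S) C^{-1}) X with S = ZᵀZ. If φ is differentiable with φ′(w) ≥ 0 for all w > 0 and 0 ≤ φ(w) ≤ (2/(n+2)) ( (∑_{i=1}^p d_i^{1−j}/c_i) / (max_{1≤i≤p} d_i^{1−j}/c_i) − 2 ) for all w > 0, and all expectations appearing in the risk computation are finite, then for every θ ∈ ℝ^p and every σ² > 0 the risk satisfies R_j(θ̂_φ, θ, σ²) ≤ R_j(X, θ, σ²); i.e., θ̂_φ dominates the least squares estimator X (and hence is minimax) under the loss L_j. -/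
open MeasureTheory Finset
open scoped ENNReal

/-- The upper tail mass of a density `f` on the real line. -/
noncomputable def tailMass (f : ℝ → ℝ) (t : ℝ) : ℝ≥0∞ := ∫⁻ s in Set.Ioi t, ENNReal.ofReal (f s)

lemma measurable_tailMass (f : ℝ → ℝ) : Measurable (tailMass f) :=
  Antitone.measurable fun _ _ h => lintegral_mono_set (Set.Ioi_subset_Ioi h)

lemma image_sq_div_add_Ioi {e : ℝ} (he : 0 < e) (r : ℝ) {a : ℝ} (ha : 0 ≤ a) :
    (fun u : ℝ => u ^ 2 / e + r) '' Set.Ioi a = Set.Ioi (a ^ 2 / e + r) := by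
  ext y
  simp only [Set.mem_image, Set.mem_Ioi]
  constructor
  · rintro ⟨u, hu, rfl⟩
    gcongr
  · intro hy
    have h1 : a ^ 2 < (y - r) * e := by
      rw [← div_lt_iff₀ he]; linarith
    refine ⟨√((y - r) * e), Real.lt_sqrt_of_sq_lt h1, ?_⟩
    rw [Real.sq_sqrt (by nlinarith [sq_nonneg a])]
    field_simp
    ring

lemma lintegral_Ioi_mul_comp_sq (f : ℝ → ℝ) {e : ℝ} (he : 0 < e) (r : ℝ) {a : ℝ} (ha : 0 ≤ a) :
    ∫⁻ u in Set.Ioi a, ENNReal.ofReal |u| * ENNReal.ofReal (f (u ^ 2 / e + r)) =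
      ENNReal.ofReal (e / 2) * tailMass f (a ^ 2 / e + r) := by
  have hinj : Set.InjOn (fun u : ℝ => u ^ 2 / e + r) (Set.Ioi a) := by
    intro u hu v hv huv
    have h : u ^ 2 = v ^ 2 := by
      have : u ^ 2 / e = v ^ 2 / e := by simpa using huv
      field_simp at this
      exact this
    exact (pow_left_inj₀ (ha.trans hu.le) (ha.trans hv.le) two_ne_zero).1 h
  have hder : ∀ u ∈ Set.Ioi a,
      HasDerivWithinAt (fun u : ℝ => u ^ 2 / e + r) (2 * u / e) (Set.Ioi a) u := by
    intro u _
    have := (((hasDerivAt_id u).pow 2).div_const e).add_const r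
    simpa using this.hasDerivWithinAt
  rw [tailMass, ← image_sq_div_add_Ioi he r ha,
    lintegral_image_eq_lintegral_abs_deriv_mul measurableSet_Ioi hder hinj,
    ← lintegral_const_mul' _ _ ENNReal.ofReal_ne_top]
  refine lintegral_congr fun u => ?_
  rw [abs_div, abs_mul, abs_of_pos he, abs_two, ← mul_assoc,
    ← ENNReal.ofReal_mul (half_pos he).le, show e / 2 * (2 * |u| / e) = |u| by field_simp]

lemma lintegral_indicator_abs_lt_mul_comp_sq (f : ℝ → ℝ) {e : ℝ} (he : 0 < e) (r x : ℝ) :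
    ∫⁻ u, {u : ℝ | |x| < |u|}.indicator
        (fun u => ENNReal.ofReal |u| * ENNReal.ofReal (f (u ^ 2 / e + r))) u =
      ENNReal.ofReal e * tailMass f (x ^ 2 / e + r) := by
  have hset : {u : ℝ | |x| < |u|} = Set.Iio (-|x|) ∪ Set.Ioi |x| := by
    ext u
    simp [lt_abs, or_comm, lt_neg]
  have hdisj : Disjoint (Set.Iio (-|x|)) (Set.Ioi |x|) := by
    rw [Set.disjoint_left]
    intro u h1 h2
    simp only [Set.mem_Iio, Set.mem_Ioi] at h1 h2
    linarith [abs_nonneg x]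
  have hneg := (Measure.measurePreserving_neg (volume : Measure ℝ)).setLIntegral_comp_preimage_emb
    (MeasurableEquiv.neg ℝ).measurableEmbedding
    (fun u => ENNReal.ofReal |u| * ENNReal.ofReal (f (u ^ 2 / e + r))) (Set.Iio (-|x|))
  simp only [abs_neg, neg_sq, Set.neg_preimage, Set.neg_Iio, neg_neg] at hneg
  rw [hset, lintegral_indicator (measurableSet_Iio.union measurableSet_Ioi),
    lintegral_union measurableSet_Ioi hdisj, ← hneg,
    lintegral_Ioi_mul_comp_sq f he r (abs_nonneg x), sq_abs, ← add_mul,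
    ← ENNReal.ofReal_add (by positivity) (by positivity), add_halves]

/-- Tonelli for the second moment against a radial density. -/
lemma lintegral_tailMass_comp_sq {f : ℝ → ℝ} (hf : Measurable f) {e : ℝ} (he : 0 < e) (r : ℝ) :
    ENNReal.ofReal e * ∫⁻ x, tailMass f (x ^ 2 / e + r) =
      2 * ∫⁻ u, ENNReal.ofReal (u ^ 2) * ENNReal.ofReal (f (u ^ 2 / e + r)) := by
  rw [← lintegral_const_mul' _ _ ENNReal.ofReal_ne_top]
  simp_rw [← lintegral_indicator_abs_lt_mul_comp_sq f he r]
  have hS : MeasurableSet {q : ℝ × ℝ | |q.1| < |q.2|} :=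
    measurableSet_lt measurable_fst.abs measurable_snd.abs
  rw [lintegral_lintegral_swap, ← lintegral_const_mul' _ _ (by simp)]
  · refine lintegral_congr fun u => ?_
    have : ∀ x : ℝ, {u : ℝ | |x| < |u|}.indicator
        (fun u => ENNReal.ofReal |u| * ENNReal.ofReal (f (u ^ 2 / e + r))) u =
        (Set.Ioo (-|u|) |u|).indicator
          (fun _ => ENNReal.ofReal |u| * ENNReal.ofReal (f (u ^ 2 / e + r))) x := by
      intro x
      simp only [Set.indicator_apply, Set.mem_ofPred_eq, Set.mem_Ioo, ← abs_lt]
    simp_rw [this]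
    rw [lintegral_indicator_const measurableSet_Ioo, Real.volume_Ioo, ← sq_abs u, mul_right_comm,
      ← ENNReal.ofReal_mul (abs_nonneg u), ← mul_assoc, show |u| * (|u| - -|u|) = 2 * |u| ^ 2 by ring,
      ENNReal.ofReal_mul two_pos.le]
    simp
  · have : Measurable fun q : ℝ × ℝ => {q : ℝ × ℝ | |q.1| < |q.2|}.indicator
        (fun q => ENNReal.ofReal |q.2| * ENNReal.ofReal (f (q.2 ^ 2 / e + r))) q :=
      Measurable.indicator (by fun_prop) hS
    exact this.aemeasurable

/-- One-dimensional Stein inequality for an even density. -/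
lemma stein_inequality_real {h g k : ℝ → ℝ} (hh : Measurable h) (h0 : ∀ u, 0 ≤ h u)
    (heven : ∀ u, h (-u) = h u) (hk : Measurable k) {C : ℝ} (hkC : ∀ x, |k x| ≤ C)
    (hg : Integrable fun u => u * g u * h u) (h2 : Integrable fun u => u ^ 2 * h u)
    (hgk : ∀ u, 0 ≤ u → ∫ x in (-u)..u, k x ≤ g u - g (-u)) :
    ∫ x, k x * ∫ u, {u : ℝ | |x| < |u|}.indicator (fun u => |u| * h u) u ≤
      2 * ∫ u, u * g u * h u := by
  have hS : MeasurableSet {q : ℝ × ℝ | |q.1| < |q.2|} :=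
    measurableSet_lt measurable_fst.abs measurable_snd.abs
  have hsec : ∀ u x : ℝ, k x * {u : ℝ | |x| < |u|}.indicator (fun u => |u| * h u) u =
      (Set.Ioo (-|u|) |u|).indicator k x * (|u| * h u) := by
    intro u x
    by_cases hx : |x| < |u|
    · rw [Set.indicator_of_mem (show u ∈ {u : ℝ | |x| < |u|} from hx),
        Set.indicator_of_mem (show x ∈ Set.Ioo (-|u|) |u| from abs_lt.1 hx)]
    · rw [Set.indicator_of_notMem (show u ∉ {u : ℝ | |x| < |u|} from hx),
        Set.indicator_of_notMem (show x ∉ Set.Ioo (-|u|) |u| from fun h => hx (abs_lt.2 h))]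
      simp
  have hkint : ∀ a b : ℝ, IntegrableOn k (Set.Ioo a b) := fun a b =>
    Measure.integrableOn_of_bounded (M := C) (by simp) hk.aestronglyMeasurable
      (Filter.Eventually.of_forall hkC)
  have hmeas : Measurable fun q : ℝ × ℝ =>
      k q.1 * {u : ℝ | |q.1| < |u|}.indicator (fun u => |u| * h u) q.2 := by
    have : Measurable fun q : ℝ × ℝ =>
        k q.1 * {q : ℝ × ℝ | |q.1| < |q.2|}.indicator (fun q => |q.2| * h q.2) q :=
      (hk.comp measurable_fst).mul (Measurable.indicator (by fun_prop) hS)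
    exact this
  have hint : Integrable (fun q : ℝ × ℝ =>
      k q.1 * {u : ℝ | |q.1| < |u|}.indicator (fun u => |u| * h u) q.2)
      (volume.prod volume) := by
    rw [integrable_prod_iff' hmeas.aestronglyMeasurable]
    constructor
    · refine Filter.Eventually.of_forall fun u => ?_
      simp only [hsec]
      exact ((integrable_indicator_iff measurableSet_Ioo).2 (hkint _ _)).mul_const _
    · refine (h2.const_mul (2 * C)).mono' ?_ (Filter.Eventually.of_forall fun u => ?_)
      · exact (hmeas.norm.stronglyMeasurable.integral_prod_left').aestronglyMeasurable
      · simp only [hsec]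
        rw [Real.norm_of_nonneg (integral_nonneg fun _ => norm_nonneg _)]
        simp only [norm_mul, norm_indicator_eq_indicator_norm]
        rw [integral_mul_const, integral_indicator measurableSet_Ioo]
        have h1 : ∫ x in Set.Ioo (-|u|) |u|, ‖k x‖ ≤ C * (2 * |u|) := by
          have := setIntegral_mono_on (hkint (-|u|) |u|).norm
            (integrableOn_const (C := C) (by simp)) measurableSet_Ioo (fun x _ => hkC x)
          refine this.trans_eq ?_
          rw [setIntegral_const]
          simp [Measure.real, Real.volume_Ioo, abs_nonneg]
          ring
        rw [Real.norm_of_nonneg (abs_nonneg u), Real.norm_of_nonneg (h0 u)]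
        calc _ ≤ C * (2 * |u|) * (|u| * h u) :=
              mul_le_mul_of_nonneg_right h1 (mul_nonneg (abs_nonneg u) (h0 u))
          _ = 2 * C * (|u| ^ 2 * h u) := by ring
          _ = _ := by rw [sq_abs]
  have hneg : Integrable fun u => u * g (-u) * h u := by
    simpa [heven] using hg.comp_neg.neg
  have hswap : ∫ u, u * g (-u) * h u = -∫ u, u * g u * h u := by
    rw [← integral_neg_eq_self, ← integral_neg]
    simp [heven]
  calc ∫ x, k x * ∫ u, {u : ℝ | |x| < |u|}.indicator (fun u => |u| * h u) u
      = ∫ u, ∫ x, k x * {u : ℝ | |x| < |u|}.indicator (fun u => |u| * h u) u := by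
        rw [← integral_integral_swap hint]
        simp_rw [integral_const_mul]
    _ = ∫ u, (∫ x in Set.Ioo (-|u|) |u|, k x) * (|u| * h u) := by
        simp_rw [hsec, integral_mul_const, integral_indicator measurableSet_Ioo]
    _ ≤ ∫ u, (u * g u * h u - u * g (-u) * h u) := by
        refine integral_mono ?_ (hg.sub hneg) fun u => ?_
        · have := hint.integral_prod_right
          simpa only [hsec, integral_mul_const, integral_indicator measurableSet_Ioo] using this
        · have h1 : ∫ x in Set.Ioo (-|u|) |u|, k x ≤ g |u| - g (-|u|) := by
            rw [← integral_Ioc_eq_integral_Ioo, ← intervalIntegral.integral_of_le (by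
              linarith [abs_nonneg u])]
            exact hgk _ (abs_nonneg u)
          refine (mul_le_mul_of_nonneg_right h1 (mul_nonneg (abs_nonneg u) (h0 u))).trans_eq ?_
          rcases abs_choice u with h | h <;> rw [h] <;> ring_nf
    _ = 2 * ∫ u, u * g u * h u := by
        rw [integral_sub hg hneg, hswap]
        ring

section Coordinate

variable {Ω β : Type*} [MeasurableSpace Ω] [MeasurableSpace β] {μ : Measure Ω} {ν : Measure β}
  [SFinite ν] {Φ : ℝ × β ≃ᵐ Ω} {X N : Ω → ℝ} {f : ℝ → ℝ} {a e : ℝ}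

lemma lintegral_tailMass_eq (hΦ : MeasurePreserving Φ (volume.prod ν) μ)
    (hX : ∀ t b, X (Φ (t, b)) = t) (hNm : Measurable N)
    (hN : ∀ t b, N (Φ (t, b)) = (t - a) ^ 2 / e + N (Φ (a, b)))
    (hf : Measurable f) (he : 0 < e) :
    ENNReal.ofReal e * ∫⁻ ω, tailMass f (N ω) ∂μ =
      2 * ∫⁻ ω, ENNReal.ofReal ((X ω - a) ^ 2) * ENNReal.ofReal (f (N ω)) ∂μ := by
  have hXm : Measurable X := by
    have : X = fun ω => (Φ.symm ω).1 := by
      ext ω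
      obtain ⟨⟨t, b⟩, rfl⟩ := Φ.surjective ω
      simp [hX]
    rw [this]
    fun_prop
  have hFm := measurable_tailMass f
  rw [← hΦ.lintegral_comp_emb Φ.measurableEmbedding, ← hΦ.lintegral_comp_emb Φ.measurableEmbedding,
    lintegral_prod_symm _ (by fun_prop), lintegral_prod_symm _ (by fun_prop),
    ← lintegral_const_mul' _ _ ENNReal.ofReal_ne_top, ← lintegral_const_mul' _ _ (by simp)]
  refine lintegral_congr fun b => ?_
  obtain ⟨ρ, hρ⟩ : ∃ ρ, ∀ t, N (Φ (t, b)) = (t - a) ^ 2 / e + ρ := ⟨_, fun t => hN t b⟩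
  have h := lintegral_tailMass_comp_sq hf he ρ
  rw [← lintegral_sub_right_eq_self _ a,
    ← lintegral_sub_right_eq_self (fun u => ENNReal.ofReal (u ^ 2) * _) a] at h
  simpa only [hX, hρ] using h

lemma integrable_tailMass_iff (hΦ : MeasurePreserving Φ (volume.prod ν) μ)
    (hX : ∀ t b, X (Φ (t, b)) = t) (hXm : Measurable X) (hNm : Measurable N)
    (hN : ∀ t b, N (Φ (t, b)) = (t - a) ^ 2 / e + N (Φ (a, b)))
    (hf : Measurable f) (hf0 : ∀ t, 0 ≤ f t) (he : 0 < e) :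
    ∫⁻ ω, tailMass f (N ω) ∂μ ≠ ∞ ↔ Integrable (fun ω => (X ω - a) ^ 2 * f (N ω)) μ := by
  have h := lintegral_tailMass_eq hΦ hX hNm hN hf he
  have hint : Integrable (fun ω => (X ω - a) ^ 2 * f (N ω)) μ ↔
      ∫⁻ ω, ENNReal.ofReal ((X ω - a) ^ 2) * ENNReal.ofReal (f (N ω)) ∂μ ≠ ∞ := by
    simp_rw [← ENNReal.ofReal_mul (sq_nonneg _)]
    rw [lintegral_ofReal_ne_top_iff_integrable (by fun_prop)
      (Filter.Eventually.of_forall fun ω => mul_nonneg (sq_nonneg _) (hf0 _))]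
  rw [hint]
  constructor
  · intro hF hc
    rw [hc] at h
    exact ENNReal.mul_ne_top ENNReal.ofReal_ne_top hF (by simpa using h)
  · intro hm hc
    rw [hc, ENNReal.mul_top (by simpa using he)] at h
    exact ENNReal.mul_ne_top (by simp) hm h.symm

/-- Stein's inequality in one coordinate, for a density that is radial in that coordinate. -/
lemma stein_inequality (hΦ : MeasurePreserving Φ (volume.prod ν) μ)
    (hX : ∀ t b, X (Φ (t, b)) = t) (hXm : Measurable X) (hNm : Measurable N)
    (hN : ∀ t b, N (Φ (t, b)) = (t - a) ^ 2 / e + N (Φ (a, b)))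
    (hf : Measurable f) (hf0 : ∀ t, 0 ≤ f t) (he : 0 < e)
    {g k : Ω → ℝ} (hk : Measurable k) {C : ℝ} (hkC : ∀ ω, |k ω| ≤ C)
    (hg : Integrable (fun ω => (X ω - a) * g ω * f (N ω)) μ)
    (h2 : ∫⁻ ω, tailMass f (N ω) ∂μ ≠ ∞)
    (hgk : ∀ b s t, s ≤ t → ∫ x in s..t, k (Φ (x, b)) ≤ g (Φ (t, b)) - g (Φ (s, b))) :
    e * ∫ ω, k ω * (tailMass f (N ω)).toReal ∂μ ≤ 2 * ∫ ω, (X ω - a) * g ω * f (N ω) ∂μ := by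
  have hFm := measurable_tailMass f
  have hsq := (integrable_tailMass_iff hΦ hX hXm hNm hN hf hf0 he).1 h2
  have hFint : Integrable (fun ω => (tailMass f (N ω)).toReal) μ :=
    integrable_toReal_of_lintegral_ne_top (by fun_prop) h2
  have hkF : Integrable (fun ω => k ω * (tailMass f (N ω)).toReal) μ :=
    hFint.bdd_mul hk.aestronglyMeasurable (Filter.Eventually.of_forall hkC)
  rw [← hΦ.integrable_comp_emb Φ.measurableEmbedding] at hg hsq hkF
  simp only [Function.comp_def] at hg hsq hkF
  rw [← hΦ.integral_comp Φ.measurableEmbedding, ← hΦ.integral_comp Φ.measurableEmbedding,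
    integral_prod_symm _ hkF, integral_prod_symm _ hg, ← integral_const_mul, ← integral_const_mul]
  refine integral_mono_ae (hkF.integral_prod_right.const_mul e)
    (hg.integral_prod_right.const_mul 2) ?_
  filter_upwards [hg.prod_left_ae, hsq.prod_left_ae] with b hgb hsqb
  obtain ⟨ρ, hρ⟩ : ∃ ρ, ∀ t, N (Φ (t, b)) = (t - a) ^ 2 / e + ρ := ⟨_, fun t => hN t b⟩
  simp only [hX, hρ] at hgb hsqb ⊢
  have key := stein_inequality_real (h := fun u => f (u ^ 2 / e + ρ))
    (g := fun u => g (Φ (u + a, b))) (k := fun x => k (Φ (x + a, b))) (C := C)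
    (by fun_prop) (fun _ => hf0 _) (fun u => by simp) (by fun_prop) (fun _ => hkC _)
    (by simpa using hgb.comp_add_right a) (by simpa using hsqb.comp_add_right a)
    (fun u hu => by
      rw [intervalIntegral.integral_comp_add_right (fun x => k (Φ (x, b)))]
      exact hgk _ _ _ (by linarith))
  have htail : ∀ x : ℝ, ∫ u, {u : ℝ | |x| < |u|}.indicator
      (fun u => |u| * f (u ^ 2 / e + ρ)) u =
        e * (tailMass f (x ^ 2 / e + ρ)).toReal := by
    intro x
    have hS : MeasurableSet {u : ℝ | |x| < |u|} := measurableSet_lt (by fun_prop) (by fun_prop)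
    have hnn : ∀ u, 0 ≤ {u : ℝ | |x| < |u|}.indicator (fun u => |u| * f (u ^ 2 / e + ρ)) u :=
      Set.indicator_nonneg fun u _ => mul_nonneg (abs_nonneg u) (hf0 _)
    rw [integral_eq_lintegral_of_nonneg_ae (Filter.Eventually.of_forall hnn)
      (Measurable.indicator (by fun_prop) hS).aestronglyMeasurable,
      ← ENNReal.toReal_ofReal he.le, ← ENNReal.toReal_mul, ENNReal.toReal_ofReal he.le,
      ← lintegral_indicator_abs_lt_mul_comp_sq f he]
    congr 2
    ext u
    by_cases hu : |x| < |u| <;> simp [hu, ENNReal.ofReal_mul]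
  simp_rw [htail] at key
  rw [← integral_sub_right_eq_self _ a, ← integral_sub_right_eq_self (fun u => u * _ * _) a] at key
  simp only [sub_add_cancel] at key
  rw [← integral_const_mul]
  simpa only [mul_left_comm] using key

end Coordinate

section Calculus

lemma intervalIntegral_le_mul_sub_mul {B B' k : ℝ → ℝ} {C : ℝ} (hB : ∀ x, |B x| ≤ C)
    (hB' : ∀ x, x ≠ 0 → HasDerivAt B (B' x) x) (hk : ∀ x, x ≠ 0 → k x ≤ B x + x * B' x)
    (hki : LocallyIntegrable k) {s t : ℝ} (hst : s ≤ t) :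
    ∫ x in s..t, k x ≤ t * B t - s * B s := by
  have hder : ∀ x, x ≠ 0 → HasDerivAt (fun x => x * B x) (B x + x * B' x) x := by
    intro x hx
    simpa using (hasDerivAt_id x).fun_mul (hB' x hx)
  have hcont : Continuous fun x => x * B x := by
    rw [continuous_iff_continuousAt]
    intro x
    rcases eq_or_ne x 0 with rfl | hx
    · rw [ContinuousAt, zero_mul]
      refine squeeze_zero_norm (a := fun x => |x| * C) (fun x => ?_) ?_
      · rw [norm_mul]
        exact mul_le_mul_of_nonneg_left (hB x) (abs_nonneg x)
      · have : Continuous fun x : ℝ => |x| * C := by fun_prop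
        simpa using this.tendsto 0
    · exact (hder x hx).continuousAt
  have hint : ∀ a b, IntegrableOn k (Set.Icc a b) := fun a b =>
    hki.integrableOn_isCompact isCompact_Icc
  have hoff : ∀ a b, a ≤ b → (0 : ℝ) ∉ Set.Ioo a b → ∫ x in a..b, k x ≤ b * B b - a * B a := by
    intro a b hab h0
    have hne : ∀ x ∈ Set.Ioo a b, x ≠ 0 := fun x hx h => h0 (h ▸ hx)
    exact intervalIntegral.integral_le_sub_of_hasDeriv_right_of_le hab hcont.continuousOn
      (fun x hx => (hder x (hne x hx)).hasDerivWithinAt) (hint a b) fun x hx => hk x (hne x hx)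
  by_cases h0 : (0 : ℝ) ∈ Set.Ioo s t
  · have hii : ∀ a b, IntervalIntegrable k volume a b := fun a b =>
      (hki.integrableOn_isCompact isCompact_uIcc).intervalIntegrable
    rw [← intervalIntegral.integral_add_adjacent_intervals (hii s 0) (hii 0 t)]
    have h1 := hoff s 0 h0.1.le (by simp)
    have h2 := hoff 0 t h0.2.le (by simp)
    linarith
  · exact hoff s t hst h0

lemma locallyIntegrable_of_abs_le {k : ℝ → ℝ} (hk : Measurable k) {C : ℝ} (hC : ∀ x, |k x| ≤ C) :
    LocallyIntegrable k :=
  (locallyIntegrable_const C).mono hk.aestronglyMeasurable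
    (Filter.Eventually.of_forall fun x => (hC x).trans (le_abs_self C))

/-- A bounded, nonnegative, nondecreasing shrinkage function on `(0, ∞)`, extended by zero. -/
structure IsShrinkage (φ : ℝ → ℝ) (K : ℝ) : Prop where
  measurable : Measurable φ
  nonneg : ∀ w, 0 ≤ φ w
  le : ∀ w, φ w ≤ K
  map_zero : φ 0 = 0
  differentiableAt : ∀ w, 0 < w → DifferentiableAt ℝ φ w
  deriv_nonneg : ∀ w, 0 < w → 0 ≤ deriv φ w

variable {φ : ℝ → ℝ} {K ε : ℝ}

lemma IsShrinkage.bound_nonneg (hφ : IsShrinkage φ K) : 0 ≤ K :=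
  (hφ.nonneg 0).trans (hφ.le 0)

lemma IsShrinkage.abs_div_le (hφ : IsShrinkage φ K) (hε : 0 < ε) {w : ℝ} (hw : 0 ≤ w) :
    |φ w / (w + ε)| ≤ K / ε := by
  rw [abs_of_nonneg (div_nonneg (hφ.nonneg w) (by positivity))]
  exact div_le_div₀ hφ.bound_nonneg (hφ.le w) hε (by linarith)

lemma IsShrinkage.abs_mul_sub_le (hφ : IsShrinkage φ K) (hε : 0 < ε) {w v : ℝ}
    (hv : 0 ≤ v) (hvw : v ≤ w) :
    |φ w * (1 / (w + ε) - 2 * v / (w + ε) ^ 2)| ≤ K / ε := by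
  have hw : 0 < w + ε := by linarith
  have h1 : |1 / (w + ε) - 2 * v / (w + ε) ^ 2| ≤ 1 / (w + ε) := by
    have : 2 * v / (w + ε) ^ 2 ≤ 2 * (1 / (w + ε)) := by
      rw [mul_one_div, div_le_div_iff₀ (by positivity) hw]
      nlinarith
    have h0 : 0 ≤ 2 * v / (w + ε) ^ 2 := by positivity
    rw [abs_le]
    constructor <;> linarith
  rw [abs_mul, abs_of_nonneg (hφ.nonneg w)]
  calc φ w * |1 / (w + ε) - 2 * v / (w + ε) ^ 2| ≤ K * (1 / (w + ε)) :=
        mul_le_mul (hφ.le w) h1 (abs_nonneg _) hφ.bound_nonneg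
    _ ≤ K * (1 / ε) := by
        have := hφ.bound_nonneg
        gcongr
        linarith
    _ = K / ε := by ring

lemma mul_div_add_sq_le {Q S T M : ℝ} (hε : 0 < ε) (hQ : 0 ≤ Q) (hS : 0 ≤ S) (hM : 0 ≤ M)
    (hT : T ≤ M * Q) : T * S / (Q + ε * S) ^ 2 ≤ M / ε := by
  rcases (show 0 ≤ Q + ε * S by positivity).eq_or_lt with h | h
  · rw [← h]
    simp only [ne_eq, OfNat.ofNat_ne_zero, not_false_eq_true, zero_pow, div_zero]
    positivity
  · rw [div_le_div_iff₀ (by positivity) hε]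
    have h1 : T * S * ε ≤ M * Q * S * ε := by gcongr
    have h2 : M * Q * S * ε ≤ M * (Q + ε * S) ^ 2 := by
      have : Q * S * ε ≤ (Q + ε * S) ^ 2 := by
        nlinarith [sq_nonneg Q, sq_nonneg (ε * S), mul_nonneg hQ (mul_nonneg hε.le hS)]
      nlinarith
    linarith

lemma IsShrinkage.integral_le_location (hφ : IsShrinkage φ K) (hε : 0 < ε) {e q S : ℝ}
    (he : 0 < e) (hq : 0 ≤ q) (hS : 0 ≤ S) {s t : ℝ} (hst : s ≤ t) :
    ∫ x in s..t, φ ((x ^ 2 / e + q) / S) * (1 / ((x ^ 2 / e + q) / S + ε) -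
        2 * (x ^ 2 / e / S) / ((x ^ 2 / e + q) / S + ε) ^ 2) ≤
      t * (φ ((t ^ 2 / e + q) / S) / ((t ^ 2 / e + q) / S + ε)) -
        s * (φ ((s ^ 2 / e + q) / S) / ((s ^ 2 / e + q) / S + ε)) := by
  rcases hS.eq_or_lt with rfl | hS
  · simp [hφ.map_zero]
  have hφm := hφ.measurable
  refine intervalIntegral_le_mul_sub_mul (C := K / ε)
    (B := fun x => φ ((x ^ 2 / e + q) / S) / ((x ^ 2 / e + q) / S + ε))
    (B' := fun x => (deriv φ ((x ^ 2 / e + q) / S) * (2 * x / e / S) * ((x ^ 2 / e + q) / S + ε) -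
      φ ((x ^ 2 / e + q) / S) * (2 * x / e / S)) / ((x ^ 2 / e + q) / S + ε) ^ 2)
    (fun x => hφ.abs_div_le hε (by positivity)) ?_ ?_
    (locallyIntegrable_of_abs_le (C := K / ε) (by fun_prop) fun x => ?_) hst
  · intro x hx
    have hw : 0 < (x ^ 2 / e + q) / S := by positivity
    have hW : HasDerivAt (fun x : ℝ => (x ^ 2 / e + q) / S) (2 * x / e / S) x := by
      simpa using ((((hasDerivAt_id x).pow 2).div_const e).add_const q).div_const S
    have h1 := (hφ.differentiableAt _ hw).hasDerivAt.comp x hW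
    exact h1.fun_div (hW.add_const ε) (by positivity)
  · intro x hx
    have hw : 0 < (x ^ 2 / e + q) / S := by positivity
    have hd := hφ.deriv_nonneg _ hw
    have hx2 : x ^ 2 / e / S = x * (x / e / S) := by ring
    generalize (x ^ 2 / e + q) / S = w at *
    have hv : 0 ≤ x ^ 2 / e / S := by positivity
    rw [← sub_nonneg]
    have : φ w / (w + ε) + x * ((deriv φ w * (2 * x / e / S) * (w + ε) - φ w * (2 * x / e / S)) /
        (w + ε) ^ 2) - φ w * (1 / (w + ε) - 2 * (x ^ 2 / e / S) / (w + ε) ^ 2) =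
        deriv φ w * (2 * (x ^ 2 / e / S)) / (w + ε) := by
      have : w + ε ≠ 0 := by positivity
      field_simp
      ring
    rw [this]
    positivity
  · refine hφ.abs_mul_sub_le hε (by positivity) ?_
    gcongr
    linarith

lemma IsShrinkage.integral_le_scale (hφ : IsShrinkage φ K) (hε : 0 < ε) {Q T M r : ℝ}
    (hQ : 0 ≤ Q) (hT : 0 ≤ T) (hM : 0 ≤ M) (hTQ : T ≤ M * Q) (hr : 0 ≤ r) {s t : ℝ} (hst : s ≤ t) :
    ∫ z in s..t, -(φ (Q / (z ^ 2 + r)) *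
        (T * (z ^ 2 + r + 2 * z ^ 2) / (Q + ε * (z ^ 2 + r)) ^ 2)) ≤
      t * -(φ (Q / (t ^ 2 + r)) * (T * (t ^ 2 + r) / (Q + ε * (t ^ 2 + r)) ^ 2)) -
        s * -(φ (Q / (s ^ 2 + r)) * (T * (s ^ 2 + r) / (Q + ε * (s ^ 2 + r)) ^ 2)) := by
  rcases hQ.eq_or_lt with rfl | hQ
  · simp [hφ.map_zero]
  have hφm := hφ.measurable
  have hK := hφ.bound_nonneg
  have hb : ∀ z : ℝ, T * (z ^ 2 + r) / (Q + ε * (z ^ 2 + r)) ^ 2 ≤ M / ε := fun z =>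
    mul_div_add_sq_le hε hQ.le (by positivity) hM hTQ
  refine intervalIntegral_le_mul_sub_mul (C := K * (M / ε))
    (B := fun z => -(φ (Q / (z ^ 2 + r)) * (T * (z ^ 2 + r) / (Q + ε * (z ^ 2 + r)) ^ 2)))
    (B' := fun z => -(deriv φ (Q / (z ^ 2 + r)) * (-(Q * (2 * z)) / (z ^ 2 + r) ^ 2) *
        (T * (z ^ 2 + r) / (Q + ε * (z ^ 2 + r)) ^ 2) + φ (Q / (z ^ 2 + r)) *
        ((T * (2 * z) * (Q + ε * (z ^ 2 + r)) ^ 2 - T * (z ^ 2 + r) *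
          (2 * (Q + ε * (z ^ 2 + r)) * (ε * (2 * z)))) / ((Q + ε * (z ^ 2 + r)) ^ 2) ^ 2)))
    (fun z => ?_) ?_ ?_
    (locallyIntegrable_of_abs_le (C := K * (3 * (M / ε))) (by fun_prop) fun z => ?_) hst
  · rw [abs_neg, abs_of_nonneg (mul_nonneg (hφ.nonneg _) (by positivity))]
    exact mul_le_mul (hφ.le _) (hb z) (by positivity) hK
  · intro z hz
    have hS : HasDerivAt (fun z : ℝ => z ^ 2 + r) (2 * z) z := by
      simpa using ((hasDerivAt_id z).pow 2).add_const r
    have hS0 : 0 < z ^ 2 + r := by positivity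
    have hw : 0 < Q / (z ^ 2 + r) := by positivity
    have hW : HasDerivAt (fun z : ℝ => Q / (z ^ 2 + r)) (-(Q * (2 * z)) / (z ^ 2 + r) ^ 2) z := by
      simpa using (hasDerivAt_const z Q).fun_div hS hS0.ne'
    have hD : HasDerivAt (fun z : ℝ => (Q + ε * (z ^ 2 + r)) ^ 2)
        (2 * (Q + ε * (z ^ 2 + r)) * (ε * (2 * z))) z := by
      simpa using ((hS.const_mul ε).const_add Q).fun_pow 2
    exact (((hφ.differentiableAt _ hw).hasDerivAt.comp z hW).fun_mul
      ((hS.const_mul T).fun_div hD (by positivity))).fun_neg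
  · intro z hz
    have hS0 : 0 < z ^ 2 + r := by positivity
    have hw : 0 < Q / (z ^ 2 + r) := by positivity
    have hd := hφ.deriv_nonneg _ hw
    have hn := hφ.nonneg (Q / (z ^ 2 + r))
    generalize deriv φ (Q / (z ^ 2 + r)) = φ' at *
    generalize φ (Q / (z ^ 2 + r)) = v at *
    generalize hSdef : z ^ 2 + r = S at *
    have hD : 0 < Q + ε * S := by positivity
    rw [← sub_nonneg]
    have : -(v * (T * S / (Q + ε * S) ^ 2)) + z * -(φ' * (-(Q * (2 * z)) / S ^ 2) *
        (T * S / (Q + ε * S) ^ 2) + v * ((T * (2 * z) * (Q + ε * S) ^ 2 - T * S *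
          (2 * (Q + ε * S) * (ε * (2 * z)))) / ((Q + ε * S) ^ 2) ^ 2)) -
        -(v * (T * (S + 2 * z ^ 2) / (Q + ε * S) ^ 2)) =
        φ' * (2 * z ^ 2 * Q * T / (S * (Q + ε * S) ^ 2)) +
          v * (4 * z ^ 2 * ε * T * S / (Q + ε * S) ^ 3) := by
      field_simp
      ring
    rw [this]
    positivity
  · rw [abs_neg, abs_of_nonneg (mul_nonneg (hφ.nonneg _) (by positivity))]
    refine mul_le_mul (hφ.le _) ?_ (by positivity) hK
    refine le_trans ?_ (mul_le_mul_of_nonneg_left (hb z) (by norm_num : (0 : ℝ) ≤ 3))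
    rw [← mul_div_assoc]
    refine div_le_div_of_nonneg_right ?_ (by positivity)
    nlinarith [mul_nonneg hT hr]

end Calculus

section CoordinateEquiv

variable (m : ℕ) (β : Type*) [MeasurableSpace β]

/-- Splitting off the `i`-th coordinate of the first component. -/
def insertCoord (i : Fin (m + 1)) : ℝ × ((Fin m → ℝ) × β) ≃ᵐ (Fin (m + 1) → ℝ) × β :=
  MeasurableEquiv.prodAssoc.symm.trans
    ((MeasurableEquiv.piFinSuccAbove (fun _ => ℝ) i).symm.prodCongr (MeasurableEquiv.refl β))

variable {m β}

lemma insertCoord_apply (i : Fin (m + 1)) (t : ℝ) (y : Fin m → ℝ) (b : β) :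
    insertCoord m β i (t, y, b) = (i.insertNth t y, b) := rfl

lemma measurePreserving_insertCoord (i : Fin (m + 1)) (ν : Measure β) [SFinite ν] :
    MeasurePreserving (insertCoord m β i) (volume.prod (volume.prod ν)) (volume.prod ν) := by
  have h1 := (measurePreserving_prodAssoc (volume : Measure ℝ)
    (volume : Measure (Fin m → ℝ)) ν).symm MeasurableEquiv.prodAssoc
  have h2 := ((volume_preserving_piFinSuccAbove (fun _ : Fin (m + 1) => ℝ) i).symm _).prod
    (MeasurePreserving.id ν)
  exact h2.comp h1

variable (m β) in
/-- Splitting off the `i`-th coordinate of the second component. -/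
def insertCoordSnd (i : Fin (m + 1)) : ℝ × ((Fin m → ℝ) × β) ≃ᵐ β × (Fin (m + 1) → ℝ) :=
  (insertCoord m β i).trans MeasurableEquiv.prodComm

lemma insertCoordSnd_apply (i : Fin (m + 1)) (t : ℝ) (y : Fin m → ℝ) (b : β) :
    insertCoordSnd m β i (t, y, b) = (b, i.insertNth t y) := rfl

lemma measurePreserving_insertCoordSnd (i : Fin (m + 1)) (ν : Measure β) [SFinite ν] :
    MeasurePreserving (insertCoordSnd m β i) (volume.prod (volume.prod ν)) (ν.prod volume) :=
  Measure.measurePreserving_swap.comp (measurePreserving_insertCoord i ν)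

end CoordinateEquiv

section Model

variable {p n : ℕ}

/-- The quadratic form `xᵀ diag(e)⁻¹ x`. -/
noncomputable def quad (e x : Fin p → ℝ) : ℝ := ∑ i, x i ^ 2 / e i

/-- The residual sum of squares `zᵀz`. -/
def sumSq (z : Fin n → ℝ) : ℝ := ∑ k, z k ^ 2

/-- The argument of the density of the canonical model. -/
noncomputable def radius (d θ : Fin p → ℝ) (σ : ℝ) (q : (Fin p → ℝ) × (Fin n → ℝ)) : ℝ :=
  (quad d (fun i => q.1 i - θ i) + sumSq q.2) / σ ^ 2

lemma quad_nonneg {e : Fin p → ℝ} (he : ∀ i, 0 < e i) (x : Fin p → ℝ) : 0 ≤ quad e x :=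
  sum_nonneg fun i _ => div_nonneg (sq_nonneg _) (he i).le

lemma sumSq_nonneg (z : Fin n → ℝ) : 0 ≤ sumSq z := sum_nonneg fun _ _ => sq_nonneg _

@[fun_prop]
lemma measurable_quad (e : Fin p → ℝ) : Measurable (quad e) := by
  unfold quad
  fun_prop

@[fun_prop]
lemma measurable_sumSq : Measurable (sumSq (n := n)) := by
  unfold sumSq
  fun_prop

@[fun_prop]
lemma measurable_radius (d θ : Fin p → ℝ) (σ : ℝ) : Measurable (radius (n := n) d θ σ) := by
  unfold radius
  fun_prop

lemma quad_insertNth {m : ℕ} (e : Fin (m + 1) → ℝ) (i : Fin (m + 1)) (t : ℝ) (y : Fin m → ℝ) :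
    quad e (i.insertNth t y) = t ^ 2 / e i + quad (fun k => e (i.succAbove k)) y := by
  simp [quad, Fin.sum_univ_succAbove _ i]

lemma sumSq_insertNth {m : ℕ} (i : Fin (m + 1)) (t : ℝ) (y : Fin m → ℝ) :
    sumSq (i.insertNth t y) = t ^ 2 + sumSq y := by
  simp [sumSq, Fin.sum_univ_succAbove _ i]

lemma radius_insertNth_fst {m : ℕ} (d θ : Fin (m + 1) → ℝ) (σ : ℝ) (i : Fin (m + 1)) (t : ℝ)
    (y : Fin m → ℝ) (z : Fin n → ℝ) :
    radius d θ σ (i.insertNth t y, z) =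
      (t - θ i) ^ 2 / (d i * σ ^ 2) + radius d θ σ (i.insertNth (θ i) y, z) := by
  simp only [radius, quad, Fin.sum_univ_succAbove _ i, Fin.insertNth_apply_same,
    Fin.insertNth_apply_succAbove, sub_self]
  ring

lemma radius_insertNth_snd {l : ℕ} (d θ : Fin p → ℝ) (σ : ℝ) (k : Fin (l + 1)) (t : ℝ)
    (y : Fin l → ℝ) (x : Fin p → ℝ) :
    radius d θ σ (x, k.insertNth t y) =
      (t - 0) ^ 2 / σ ^ 2 + radius d θ σ (x, k.insertNth 0 y) := by
  simp only [radius, sumSq_insertNth]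
  ring

variable {d c θ : Fin p → ℝ} {σ : ℝ} {f φ : ℝ → ℝ} {K ε : ℝ}

lemma lintegral_tailMass_ne_top_iff_location (hd : ∀ i, 0 < d i) (hσ : 0 < σ) (hf : Measurable f)
    (hf0 : ∀ t, 0 ≤ f t) (i : Fin p) :
    ∫⁻ q : (Fin p → ℝ) × (Fin n → ℝ), tailMass f (radius d θ σ q) ≠ ∞ ↔
      Integrable fun q : (Fin p → ℝ) × (Fin n → ℝ) =>
        (q.1 i - θ i) ^ 2 * f (radius d θ σ q) := by
  cases p with
  | zero => exact i.elim0
  | succ m =>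
    exact integrable_tailMass_iff (e := d i * σ ^ 2) (X := fun q => q.1 i)
      (Φ := insertCoord m (Fin n → ℝ) i) (measurePreserving_insertCoord i volume)
      (fun t ⟨_, _⟩ => by simp [insertCoord_apply]) (by fun_prop) (by fun_prop)
      (fun t b => radius_insertNth_fst d θ σ i t b.1 b.2) hf hf0 (mul_pos (hd i) (by positivity))

lemma lintegral_tailMass_ne_top_iff_scale (hσ : 0 < σ) (hf : Measurable f)
    (hf0 : ∀ t, 0 ≤ f t) (k : Fin n) :
    ∫⁻ q : (Fin p → ℝ) × (Fin n → ℝ), tailMass f (radius d θ σ q) ≠ ∞ ↔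
      Integrable fun q : (Fin p → ℝ) × (Fin n → ℝ) =>
        (q.2 k - 0) ^ 2 * f (radius d θ σ q) := by
  cases n with
  | zero => exact k.elim0
  | succ l =>
    exact integrable_tailMass_iff (e := σ ^ 2) (X := fun q => q.2 k)
      (Φ := insertCoordSnd l (Fin p → ℝ) k)
      (measurePreserving_insertCoordSnd k volume) (fun t ⟨_, _⟩ => by simp [insertCoordSnd_apply])
      (by fun_prop) (by fun_prop)
      (fun t b => radius_insertNth_snd d θ σ k t b.1 b.2) hf hf0 (by positivity)

lemma stein_location (hφ : IsShrinkage φ K) (hε : 0 < ε) (hd : ∀ i, 0 < d i) (hc : ∀ i, 0 < c i)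
    (hσ : 0 < σ) (hf : Measurable f) (hf0 : ∀ t, 0 ≤ f t) (i : Fin p)
    (h2 : ∫⁻ q : (Fin p → ℝ) × (Fin n → ℝ), tailMass f (radius d θ σ q) ≠ ∞)
    (hg : Integrable fun q : (Fin p → ℝ) × (Fin n → ℝ) => (q.1 i - θ i) *
      (q.1 i * (φ (quad (c * d) q.1 / sumSq q.2) / (quad (c * d) q.1 / sumSq q.2 + ε))) *
        f (radius d θ σ q)) :
    d i * σ ^ 2 * ∫ q : (Fin p → ℝ) × (Fin n → ℝ),
        φ (quad (c * d) q.1 / sumSq q.2) * (1 / (quad (c * d) q.1 / sumSq q.2 + ε) -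
          2 * (q.1 i ^ 2 / (c * d) i / sumSq q.2) / (quad (c * d) q.1 / sumSq q.2 + ε) ^ 2) *
          (tailMass f (radius d θ σ q)).toReal ≤
      2 * ∫ q : (Fin p → ℝ) × (Fin n → ℝ), (q.1 i - θ i) *
        (q.1 i * (φ (quad (c * d) q.1 / sumSq q.2) / (quad (c * d) q.1 / sumSq q.2 + ε))) *
          f (radius d θ σ q) := by
  have hcd : ∀ i, 0 < (c * d) i := fun i => mul_pos (hc i) (hd i)
  have hφm := hφ.measurable
  cases p with
  | zero => exact i.elim0
  | succ m =>
    refine stein_inequality (e := d i * σ ^ 2) (X := fun q => q.1 i) (C := K / ε)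
      (Φ := insertCoord m (Fin n → ℝ) i) (measurePreserving_insertCoord i volume)
      (fun t ⟨_, _⟩ => by simp [insertCoord_apply]) (by fun_prop) (by fun_prop)
      (fun t b => radius_insertNth_fst d θ σ i t b.1 b.2) hf hf0 (mul_pos (hd i) (by positivity))
      (by fun_prop) (fun q => ?_) hg h2 ?_
    · refine hφ.abs_mul_sub_le hε (div_nonneg (div_nonneg (sq_nonneg _) (hcd i).le)
        (sumSq_nonneg _)) (div_le_div_of_nonneg_right ?_ (sumSq_nonneg _))
      exact single_le_sum (f := fun i => q.1 i ^ 2 / (c * d) i)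
        (fun i _ => div_nonneg (sq_nonneg _) (hcd i).le) (mem_univ i)
    · rintro ⟨y, z⟩ s t hst
      simp only [insertCoord_apply, quad_insertNth, Fin.insertNth_apply_same]
      exact hφ.integral_le_location hε (hcd i) (quad_nonneg (fun _ => hcd _) y) (sumSq_nonneg z) hst

lemma stein_scale (hφ : IsShrinkage φ K) (hε : 0 < ε) {Q T : (Fin p → ℝ) → ℝ} {M : ℝ}
    (hQm : Measurable Q) (hTm : Measurable T) (hQ : ∀ x, 0 ≤ Q x) (hT : ∀ x, 0 ≤ T x)
    (hM : 0 ≤ M) (hTQ : ∀ x, T x ≤ M * Q x)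
    (hσ : 0 < σ) (hf : Measurable f) (hf0 : ∀ t, 0 ≤ f t) (k : Fin n)
    (h2 : ∫⁻ q : (Fin p → ℝ) × (Fin n → ℝ), tailMass f (radius d θ σ q) ≠ ∞)
    (hg : Integrable fun q : (Fin p → ℝ) × (Fin n → ℝ) => (q.2 k - 0) *
      (q.2 k * -(φ (Q q.1 / sumSq q.2) * (T q.1 * sumSq q.2 / (Q q.1 + ε * sumSq q.2) ^ 2))) *
        f (radius d θ σ q)) :
    σ ^ 2 * ∫ q : (Fin p → ℝ) × (Fin n → ℝ),
        -(φ (Q q.1 / sumSq q.2) *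
          (T q.1 * (sumSq q.2 + 2 * q.2 k ^ 2) / (Q q.1 + ε * sumSq q.2) ^ 2)) *
          (tailMass f (radius d θ σ q)).toReal ≤
      2 * ∫ q : (Fin p → ℝ) × (Fin n → ℝ), (q.2 k - 0) *
      (q.2 k * -(φ (Q q.1 / sumSq q.2) * (T q.1 * sumSq q.2 / (Q q.1 + ε * sumSq q.2) ^ 2))) *
        f (radius d θ σ q) := by
  have hφm := hφ.measurable
  cases n with
  | zero => exact k.elim0
  | succ l =>
    refine stein_inequality (e := σ ^ 2) (X := fun q => q.2 k) (C := K * (3 * (M / ε)))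
      (Φ := insertCoordSnd l (Fin p → ℝ) k)
      (measurePreserving_insertCoordSnd k volume) (fun t ⟨_, _⟩ => by simp [insertCoordSnd_apply])
      (by fun_prop) (by fun_prop)
      (fun t b => radius_insertNth_snd d θ σ k t b.1 b.2) hf hf0 (by positivity)
      (by fun_prop) (fun q => ?_) hg h2 ?_
    · have hS := sumSq_nonneg q.2
      have hz : q.2 k ^ 2 ≤ sumSq q.2 :=
        single_le_sum (f := fun k => q.2 k ^ 2) (fun _ _ => sq_nonneg _) (mem_univ k)
      have hTn := hT q.1
      rw [abs_neg, abs_of_nonneg (mul_nonneg (hφ.nonneg _) (by positivity))]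
      refine mul_le_mul (hφ.le _) ?_ (by positivity) hφ.bound_nonneg
      refine le_trans ?_ (mul_le_mul_of_nonneg_left
        (mul_div_add_sq_le hε (hQ q.1) hS hM (hTQ q.1)) (by norm_num : (0 : ℝ) ≤ 3))
      rw [← mul_div_assoc]
      refine div_le_div_of_nonneg_right ?_ (by positivity)
      nlinarith
    · rintro ⟨y, x⟩ s t hst
      simp only [insertCoordSnd_apply, sumSq_insertNth, Fin.insertNth_apply_same]
      exact hφ.integral_le_scale hε (hQ x) (hT x) hM (hTQ x) (sumSq_nonneg y) hst

lemma IsShrinkage.sq_mul_le (hφ : IsShrinkage φ K) (hε : 0 < ε) {Q S T : ℝ} (hQ : 0 ≤ Q)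
    (hS : 0 ≤ S) (hT : 0 ≤ T) :
    (φ (Q / S) / (Q / S + ε)) ^ 2 * T ≤
      K * (S * (φ (Q / S) * (T * S / (Q + ε * S) ^ 2))) := by
  rcases hS.eq_or_lt with rfl | hS
  · simp [hφ.map_zero]
  have hD : 0 < Q + ε * S := by positivity
  have hn := hφ.nonneg (Q / S)
  have hle := hφ.le (Q / S)
  have h : Q / S + ε = (Q + ε * S) / S := by field_simp
  rw [h]
  generalize φ (Q / S) = v at *
  calc (v / ((Q + ε * S) / S)) ^ 2 * T = v * (v * (S * (T * S / (Q + ε * S) ^ 2))) := by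
        field_simp
    _ ≤ K * (v * (S * (T * S / (Q + ε * S) ^ 2))) := by gcongr
    _ = _ := by ring

lemma IsShrinkage.mul_le_sum (hφ : IsShrinkage φ K) (hε : 0 < ε) {b v : Fin p → ℝ} {S M L : ℝ}
    (hS : 0 ≤ S) (hb : ∀ i, 0 ≤ b i) (hbM : ∀ i, b i ≤ M) (hv : ∀ i, 0 ≤ v i) (hL : 0 ≤ L)
    (hK : K * (L * M) ≤ 2 * (∑ i, b i - 2 * M)) :
    K * (φ ((∑ i, v i) / S) * (L * ((∑ i, b i * v i) * S) / (∑ i, v i + ε * S) ^ 2)) ≤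
      2 * ∑ i, b i * (φ ((∑ i, v i) / S) * (1 / ((∑ i, v i) / S + ε) -
        2 * (v i / S) / ((∑ i, v i) / S + ε) ^ 2)) := by
  rcases hS.eq_or_lt with rfl | hS
  · simp [hφ.map_zero]
  have hTQ : ∑ i, b i * v i ≤ M * ∑ i, v i := by
    rw [mul_sum]
    exact sum_le_sum fun i _ => mul_le_mul_of_nonneg_right (hbM i) (hv i)
  have hQ : 0 ≤ ∑ i, v i := sum_nonneg fun i _ => hv i
  have hB : 0 ≤ ∑ i, b i := sum_nonneg fun i _ => hb i
  have hn := hφ.nonneg ((∑ i, v i) / S)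
  have hK0 := hφ.bound_nonneg
  have hsum : ∑ i, b i * (φ ((∑ i, v i) / S) * (1 / ((∑ i, v i) / S + ε) -
        2 * (v i / S) / ((∑ i, v i) / S + ε) ^ 2)) =
      φ ((∑ i, v i) / S) * ((∑ i, b i) / ((∑ i, v i) / S + ε) -
        2 * ((∑ i, b i * v i) / S) / ((∑ i, v i) / S + ε) ^ 2) := by
    simp only [sum_div, mul_sum, ← sum_sub_distrib]
    refine sum_congr rfl fun i _ => ?_
    ring
  rw [hsum]
  generalize φ ((∑ i, v i) / S) = u at *
  generalize ∑ i, v i = Q at *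
  generalize ∑ i, b i * v i = T at *
  generalize ∑ i, b i = B at *
  have hD : 0 < Q + ε * S := by positivity
  have h : Q / S + ε = (Q + ε * S) / S := by field_simp
  have hmain : K * (L * T) ≤ 2 * (B * (Q + ε * S) - 2 * T) := by
    have h1 : K * (L * T) ≤ K * (L * (M * Q)) := by gcongr
    have h2 : K * (L * M) * Q ≤ 2 * (B - 2 * M) * Q := mul_le_mul_of_nonneg_right hK hQ
    have h3 : 0 ≤ B * (ε * S) := by positivity
    linarith
  calc K * (u * (L * (T * S) / (Q + ε * S) ^ 2)) = u * S / (Q + ε * S) ^ 2 * (K * (L * T)) := by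
        ring
    _ ≤ u * S / (Q + ε * S) ^ 2 * (2 * (B * (Q + ε * S) - 2 * T)) := by gcongr
    _ = _ := by
        rw [h]
        field_simp

lemma regularized_risk_le (hφ : IsShrinkage φ K) (hε : 0 < ε) (hp : 0 < p) (hd : ∀ i, 0 < d i)
    (hc : ∀ i, 0 < c i) (hσ : 0 < σ) (hf : Measurable f) (hf0 : ∀ t, 0 ≤ f t)
    {w : Fin p → ℝ} {M : ℝ} (hw : ∀ i, 0 ≤ w i) (hM : ∀ i, d i * w i ≤ M)
    (hK : K * (((n : ℝ) + 2) * M) ≤ 2 * (∑ i, d i * w i - 2 * M))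
    (h0 : Integrable fun q : (Fin p → ℝ) × (Fin n → ℝ) => f (radius d θ σ q))
    (h2 : ∀ i, Integrable fun q : (Fin p → ℝ) × (Fin n → ℝ) =>
      (q.1 i - θ i) ^ 2 * f (radius d θ σ q)) :
    (Integrable fun q : (Fin p → ℝ) × (Fin n → ℝ) => (∑ i, w i * ((q.1 i - θ i) *
      (q.1 i * (φ (quad (c * d) q.1 / sumSq q.2) / (quad (c * d) q.1 / sumSq q.2 + ε))))) *
        f (radius d θ σ q)) ∧
    (Integrable fun q : (Fin p → ℝ) × (Fin n → ℝ) =>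
      (φ (quad (c * d) q.1 / sumSq q.2) / (quad (c * d) q.1 / sumSq q.2 + ε)) ^ 2 *
        (∑ i, d i * w i * (q.1 i ^ 2 / (c * d) i)) * f (radius d θ σ q)) ∧
    ∫ q : (Fin p → ℝ) × (Fin n → ℝ),
      (φ (quad (c * d) q.1 / sumSq q.2) / (quad (c * d) q.1 / sumSq q.2 + ε)) ^ 2 *
        (∑ i, d i * w i * (q.1 i ^ 2 / (c * d) i)) * f (radius d θ σ q) ≤
      2 * ∫ q : (Fin p → ℝ) × (Fin n → ℝ), (∑ i, w i * ((q.1 i - θ i) *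
      (q.1 i * (φ (quad (c * d) q.1 / sumSq q.2) / (quad (c * d) q.1 / sumSq q.2 + ε))))) *
        f (radius d θ σ q) := by
  have hcd : ∀ i, 0 < (c * d) i := fun i => mul_pos (hc i) (hd i)
  have hb : ∀ i, 0 ≤ d i * w i := fun i => mul_nonneg (hd i).le (hw i)
  have hM0 : 0 ≤ M := (hb ⟨0, hp⟩).trans (hM _)
  have hφm := hφ.measurable
  have hFm := measurable_tailMass f
  have hK0 := hφ.bound_nonneg
  have hv : ∀ (x : Fin p → ℝ) i, 0 ≤ x i ^ 2 / (c * d) i := fun x i =>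
    div_nonneg (sq_nonneg _) (hcd i).le
  obtain ⟨T, hTdef⟩ : ∃ T : (Fin p → ℝ) → ℝ,
      T = fun x => ∑ i, d i * w i * (x i ^ 2 / (c * d) i) := ⟨_, rfl⟩
  have hTm : Measurable T := by rw [hTdef]; fun_prop
  have hT : ∀ x, 0 ≤ T x := fun x => by
    rw [hTdef]
    exact sum_nonneg fun i _ => mul_nonneg (hb i) (hv x i)
  have hTQ : ∀ x, T x ≤ M * quad (c * d) x := fun x => by
    rw [hTdef, quad, mul_sum]
    exact sum_le_sum fun i _ => mul_le_mul_of_nonneg_right (hM i) (hv x i)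
  have hQ : ∀ x, 0 ≤ quad (c * d) x := quad_nonneg hcd
  have htail := (lintegral_tailMass_ne_top_iff_location (n := n) (θ := θ) hd hσ hf hf0
    ⟨0, hp⟩).2 (h2 _)
  have hF : Integrable fun q : (Fin p → ℝ) × (Fin n → ℝ) =>
      (tailMass f (radius d θ σ q)).toReal :=
    integrable_toReal_of_lintegral_ne_top (by fun_prop) htail
  have hψ : ∀ q : (Fin p → ℝ) × (Fin n → ℝ),
      |φ (quad (c * d) q.1 / sumSq q.2) / (quad (c * d) q.1 / sumSq q.2 + ε)| ≤ K / ε := fun q =>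
    hφ.abs_div_le hε (div_nonneg (hQ _) (sumSq_nonneg _))
  have h1 : ∀ i, Integrable fun q : (Fin p → ℝ) × (Fin n → ℝ) =>
      (q.1 i - θ i) * f (radius d θ σ q) := fun i => by
    refine (h0.add (h2 i)).mono' (by fun_prop) (Filter.Eventually.of_forall fun q => ?_)
    rw [norm_mul, Real.norm_of_nonneg (hf0 _), Pi.add_apply]
    have : |q.1 i - θ i| ≤ 1 + (q.1 i - θ i) ^ 2 := by
      rw [abs_le]
      constructor <;> nlinarith [sq_nonneg (q.1 i - θ i + 1), sq_nonneg (q.1 i - θ i - 1)]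
    calc _ ≤ (1 + (q.1 i - θ i) ^ 2) * f (radius d θ σ q) :=
          mul_le_mul_of_nonneg_right this (hf0 _)
      _ = _ := by ring
  have hx : ∀ i, Integrable fun q : (Fin p → ℝ) × (Fin n → ℝ) => (q.1 i - θ i) *
      (q.1 i * (φ (quad (c * d) q.1 / sumSq q.2) / (quad (c * d) q.1 / sumSq q.2 + ε))) *
        f (radius d θ σ q) := fun i => by
    have := ((h2 i).add ((h1 i).const_mul (θ i))).bdd_mul (c := K / ε)
      (f := fun q : (Fin p → ℝ) × (Fin n → ℝ) =>
        φ (quad (c * d) q.1 / sumSq q.2) / (quad (c * d) q.1 / sumSq q.2 + ε))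
      (Measurable.aestronglyMeasurable (by fun_prop)) (Filter.Eventually.of_forall hψ)
    refine this.congr (Filter.Eventually.of_forall fun q => ?_)
    simp only [Pi.add_apply]
    ring
  have hzb : ∀ q : (Fin p → ℝ) × (Fin n → ℝ), |φ (quad (c * d) q.1 / sumSq q.2) *
      (T q.1 * sumSq q.2 / (quad (c * d) q.1 + ε * sumSq q.2) ^ 2)| ≤ K * (M / ε) := fun q => by
    have hnn : 0 ≤ T q.1 * sumSq q.2 / (quad (c * d) q.1 + ε * sumSq q.2) ^ 2 :=
      div_nonneg (mul_nonneg (hT _) (sumSq_nonneg _)) (sq_nonneg _)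
    rw [abs_of_nonneg (mul_nonneg (hφ.nonneg _) hnn)]
    exact mul_le_mul (hφ.le _) (mul_div_add_sq_le hε (hQ _) (sumSq_nonneg _) hM0 (hTQ _)) hnn hK0
  have hz : ∀ k, Integrable fun q : (Fin p → ℝ) × (Fin n → ℝ) => (q.2 k - 0) *
      (q.2 k * -(φ (quad (c * d) q.1 / sumSq q.2) *
        (T q.1 * sumSq q.2 / (quad (c * d) q.1 + ε * sumSq q.2) ^ 2))) *
        f (radius d θ σ q) := fun k => by
    have := (((lintegral_tailMass_ne_top_iff_scale hσ hf hf0 k).1 htail).bdd_mul (c := K * (M / ε))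
      (f := fun q : (Fin p → ℝ) × (Fin n → ℝ) => φ (quad (c * d) q.1 / sumSq q.2) *
        (T q.1 * sumSq q.2 / (quad (c * d) q.1 + ε * sumSq q.2) ^ 2))
      (by fun_prop) (Filter.Eventually.of_forall hzb)).neg
    refine this.congr (Filter.Eventually.of_forall fun q => ?_)
    simp only [Pi.neg_apply, sub_zero]
    ring
  have hX : ∀ i, _ := fun i => stein_location hφ hε hd hc hσ hf hf0 i htail (hx i)
  have hkx : ∀ i, Integrable fun q : (Fin p → ℝ) × (Fin n → ℝ) =>
      φ (quad (c * d) q.1 / sumSq q.2) * (1 / (quad (c * d) q.1 / sumSq q.2 + ε) -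
        2 * (q.1 i ^ 2 / (c * d) i / sumSq q.2) / (quad (c * d) q.1 / sumSq q.2 + ε) ^ 2) *
        (tailMass f (radius d θ σ q)).toReal := fun i => by
    refine hF.bdd_mul (c := K / ε) (by fun_prop) (Filter.Eventually.of_forall fun q => ?_)
    refine hφ.abs_mul_sub_le hε (div_nonneg (hv _ i) (sumSq_nonneg _))
      (div_le_div_of_nonneg_right ?_ (sumSq_nonneg _))
    exact single_le_sum (f := fun i => q.1 i ^ 2 / (c * d) i) (fun i _ => hv _ i) (mem_univ i)
  have hA : Integrable fun q : (Fin p → ℝ) × (Fin n → ℝ) => (∑ i, w i * ((q.1 i - θ i) *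
      (q.1 i * (φ (quad (c * d) q.1 / sumSq q.2) / (quad (c * d) q.1 / sumSq q.2 + ε))))) *
        f (radius d θ σ q) := by
    simp only [sum_mul, mul_assoc (w _)]
    exact integrable_finsetSum _ fun i _ => (hx i).const_mul (w i)
  have hAX : σ ^ 2 * ∫ q : (Fin p → ℝ) × (Fin n → ℝ), (∑ i, d i * w i *
      (φ (quad (c * d) q.1 / sumSq q.2) * (1 / (quad (c * d) q.1 / sumSq q.2 + ε) -
        2 * (q.1 i ^ 2 / (c * d) i / sumSq q.2) / (quad (c * d) q.1 / sumSq q.2 + ε) ^ 2))) *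
        (tailMass f (radius d θ σ q)).toReal ≤
      2 * ∫ q : (Fin p → ℝ) × (Fin n → ℝ), (∑ i, w i * ((q.1 i - θ i) *
      (q.1 i * (φ (quad (c * d) q.1 / sumSq q.2) / (quad (c * d) q.1 / sumSq q.2 + ε))))) *
        f (radius d θ σ q) := by
    simp only [sum_mul, mul_assoc (w _), mul_assoc (d _ * w _)]
    rw [integral_finsetSum _ fun i _ => (hkx i).const_mul (d i * w i),
      integral_finsetSum _ fun i _ => (hx i).const_mul (w i), mul_sum, mul_sum]
    refine sum_le_sum fun i _ => ?_
    rw [integral_const_mul, integral_const_mul]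
    linarith [mul_le_mul_of_nonneg_left (hX i) (hw i)]
  have hkAint : Integrable fun q : (Fin p → ℝ) × (Fin n → ℝ) => (∑ i, d i * w i *
      (φ (quad (c * d) q.1 / sumSq q.2) * (1 / (quad (c * d) q.1 / sumSq q.2 + ε) -
        2 * (q.1 i ^ 2 / (c * d) i / sumSq q.2) / (quad (c * d) q.1 / sumSq q.2 + ε) ^ 2))) *
        (tailMass f (radius d θ σ q)).toReal := by
    simp only [sum_mul, mul_assoc (d _ * w _)]
    exact integrable_finsetSum _ fun i _ => (hkx i).const_mul (d i * w i)
  have hZ : ∀ k, _ := fun k => stein_scale hφ hε (measurable_quad (c * d)) hTm hQ hT hM0 hTQ hσ hf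
    hf0 k htail (hz k)
  have hkz : Integrable fun q : (Fin p → ℝ) × (Fin n → ℝ) => φ (quad (c * d) q.1 / sumSq q.2) *
      (T q.1 * sumSq q.2 / (quad (c * d) q.1 + ε * sumSq q.2) ^ 2) *
        (tailMass f (radius d θ σ q)).toReal :=
    hF.bdd_mul (c := K * (M / ε)) (Measurable.aestronglyMeasurable (by fun_prop))
      (Filter.Eventually.of_forall hzb)
  have hkzk : ∀ k, Integrable fun q : (Fin p → ℝ) × (Fin n → ℝ) =>
      -(φ (quad (c * d) q.1 / sumSq q.2) * (T q.1 * (sumSq q.2 + 2 * q.2 k ^ 2) /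
        (quad (c * d) q.1 + ε * sumSq q.2) ^ 2)) * (tailMass f (radius d θ σ q)).toReal := by
    intro k
    refine (hkz.const_mul 3).mono' (Measurable.aestronglyMeasurable (by fun_prop))
      (Filter.Eventually.of_forall fun q => ?_)
    have hS := sumSq_nonneg q.2
    have hTn := hT q.1
    have hzk : q.2 k ^ 2 ≤ sumSq q.2 :=
      single_le_sum (f := fun k => q.2 k ^ 2) (fun _ _ => sq_nonneg _) (mem_univ k)
    have hφn := hφ.nonneg (quad (c * d) q.1 / sumSq q.2)
    have hnn : 0 ≤ φ (quad (c * d) q.1 / sumSq q.2) * (T q.1 * (sumSq q.2 + 2 * q.2 k ^ 2) /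
        (quad (c * d) q.1 + ε * sumSq q.2) ^ 2) := by positivity
    have hF0 : 0 ≤ (tailMass f (radius d θ σ q)).toReal := ENNReal.toReal_nonneg
    rw [norm_mul, norm_neg, Real.norm_of_nonneg hnn, Real.norm_of_nonneg hF0, ← mul_assoc]
    refine mul_le_mul_of_nonneg_right ?_ hF0
    rw [mul_left_comm, ← mul_div_assoc (3 : ℝ)]
    refine mul_le_mul_of_nonneg_left (div_le_div_of_nonneg_right ?_ (sq_nonneg _)) hφn
    nlinarith
  have hBint : Integrable fun q : (Fin p → ℝ) × (Fin n → ℝ) => sumSq q.2 *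
      (φ (quad (c * d) q.1 / sumSq q.2) *
        (T q.1 * sumSq q.2 / (quad (c * d) q.1 + ε * sumSq q.2) ^ 2)) * f (radius d θ σ q) := by
    refine (integrable_finsetSum univ fun k _ => hz k).neg.congr
      (Filter.Eventually.of_forall fun q => ?_)
    simp only [Pi.neg_apply, sumSq, sum_mul, ← sum_neg_distrib]
    refine sum_congr rfl fun k _ => ?_
    ring
  have hBZ : 2 * ∫ q : (Fin p → ℝ) × (Fin n → ℝ), sumSq q.2 *
      (φ (quad (c * d) q.1 / sumSq q.2) *
        (T q.1 * sumSq q.2 / (quad (c * d) q.1 + ε * sumSq q.2) ^ 2)) * f (radius d θ σ q) ≤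
      σ ^ 2 * ∫ q : (Fin p → ℝ) × (Fin n → ℝ), φ (quad (c * d) q.1 / sumSq q.2) *
        (((n : ℝ) + 2) * (T q.1 * sumSq q.2) / (quad (c * d) q.1 + ε * sumSq q.2) ^ 2) *
        (tailMass f (radius d θ σ q)).toReal := by
    have hsum := sum_le_sum fun k (_ : k ∈ univ) => hZ k
    rw [← mul_sum, ← mul_sum, ← integral_finsetSum _ fun k _ => hkzk k,
      ← integral_finsetSum _ fun k _ => hz k] at hsum
    have e1 : ∀ q : (Fin p → ℝ) × (Fin n → ℝ), ∑ k, -(φ (quad (c * d) q.1 / sumSq q.2) *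
        (T q.1 * (sumSq q.2 + 2 * q.2 k ^ 2) /
        (quad (c * d) q.1 + ε * sumSq q.2) ^ 2)) * (tailMass f (radius d θ σ q)).toReal =
        -(φ (quad (c * d) q.1 / sumSq q.2) *
        (((n : ℝ) + 2) * (T q.1 * sumSq q.2) / (quad (c * d) q.1 + ε * sumSq q.2) ^ 2) *
        (tailMass f (radius d θ σ q)).toReal) := by
      intro q
      have h : ∑ k, (sumSq q.2 + 2 * q.2 k ^ 2) = ((n : ℝ) + 2) * sumSq q.2 := by
        rw [sum_add_distrib, ← mul_sum]
        simp [sumSq]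
        ring
      rw [← sum_mul, sum_neg_distrib, ← mul_sum, ← sum_div, ← mul_sum, h]
      ring
    have e2 : ∀ q : (Fin p → ℝ) × (Fin n → ℝ), ∑ k, (q.2 k - 0) *
        (q.2 k * -(φ (quad (c * d) q.1 / sumSq q.2) *
        (T q.1 * sumSq q.2 / (quad (c * d) q.1 + ε * sumSq q.2) ^ 2))) *
        f (radius d θ σ q) = -(sumSq q.2 *
      (φ (quad (c * d) q.1 / sumSq q.2) *
        (T q.1 * sumSq q.2 / (quad (c * d) q.1 + ε * sumSq q.2) ^ 2)) * f (radius d θ σ q)) := by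
      intro q
      generalize φ (quad (c * d) q.1 / sumSq q.2) *
        (T q.1 * sumSq q.2 / (quad (c * d) q.1 + ε * sumSq q.2) ^ 2) = v
      simp only [sumSq, sum_mul, ← sum_neg_distrib]
      refine sum_congr rfl fun k _ => ?_
      ring
    simp_rw [e1, e2, integral_neg] at hsum
    linarith
  have hTeq : ∀ x, ∑ i, d i * w i * (x i ^ 2 / (c * d) i) = T x := fun x => by rw [hTdef]
  simp only [hTeq]
  have hle : ∀ q : (Fin p → ℝ) × (Fin n → ℝ),
      (φ (quad (c * d) q.1 / sumSq q.2) / (quad (c * d) q.1 / sumSq q.2 + ε)) ^ 2 *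
        T q.1 * f (radius d θ σ q) ≤ K * (sumSq q.2 * (φ (quad (c * d) q.1 / sumSq q.2) *
        (T q.1 * sumSq q.2 / (quad (c * d) q.1 + ε * sumSq q.2) ^ 2)) * f (radius d θ σ q)) := by
    intro q
    rw [← mul_assoc]
    exact mul_le_mul_of_nonneg_right (hφ.sq_mul_le hε (hQ _) (sumSq_nonneg _) (hT _)) (hf0 _)
  have hC : Integrable fun q : (Fin p → ℝ) × (Fin n → ℝ) =>
      (φ (quad (c * d) q.1 / sumSq q.2) / (quad (c * d) q.1 / sumSq q.2 + ε)) ^ 2 *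
        T q.1 * f (radius d θ σ q) := by
    refine (hBint.const_mul K).mono' (Measurable.aestronglyMeasurable (by fun_prop))
      (Filter.Eventually.of_forall fun q => ?_)
    rw [Real.norm_of_nonneg (mul_nonneg (mul_nonneg (sq_nonneg _) (hT _)) (hf0 _))]
    exact hle q
  refine ⟨hA, hC, ?_⟩
  have hCB := integral_mono hC (hBint.const_mul K) hle
  rw [integral_const_mul] at hCB
  have hcmp : K * ∫ q : (Fin p → ℝ) × (Fin n → ℝ), φ (quad (c * d) q.1 / sumSq q.2) *
        (((n : ℝ) + 2) * (T q.1 * sumSq q.2) / (quad (c * d) q.1 + ε * sumSq q.2) ^ 2) *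
        (tailMass f (radius d θ σ q)).toReal ≤
      2 * ∫ q : (Fin p → ℝ) × (Fin n → ℝ), (∑ i, d i * w i *
      (φ (quad (c * d) q.1 / sumSq q.2) * (1 / (quad (c * d) q.1 / sumSq q.2 + ε) -
        2 * (q.1 i ^ 2 / (c * d) i / sumSq q.2) / (quad (c * d) q.1 / sumSq q.2 + ε) ^ 2))) *
        (tailMass f (radius d θ σ q)).toReal := by
    rw [← integral_const_mul, ← integral_const_mul]
    refine integral_mono ?_ (hkAint.const_mul 2) fun q => ?_
    · refine ((hkz.const_mul ((n : ℝ) + 2)).const_mul K).congr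
        (Filter.Eventually.of_forall fun q => ?_)
      simp only
      ring
    · have := hφ.mul_le_sum hε (sumSq_nonneg q.2) hb hM (hv q.1)
        (by positivity : (0 : ℝ) ≤ (n : ℝ) + 2) hK
      simp only [hTeq] at this
      simp only [← mul_assoc] at this ⊢
      exact mul_le_mul_of_nonneg_right this ENNReal.toReal_nonneg
  have := mul_le_mul_of_nonneg_left hBZ hK0
  have := mul_le_mul_of_nonneg_left hcmp (sq_nonneg σ)
  linarith

end Model

lemma isShrinkage_indicator {φ : ℝ → ℝ} {K : ℝ}
    (hdiff : ∀ w > (0 : ℝ), DifferentiableAt ℝ φ w) (hincr : ∀ w > (0 : ℝ), 0 ≤ deriv φ w)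
    (hnonneg : ∀ w > (0 : ℝ), 0 ≤ φ w) (hle : ∀ w > (0 : ℝ), φ w ≤ K) :
    IsShrinkage ((Set.Ioi 0).indicator φ) K := by
  have heq : ∀ w, 0 < w → (Set.Ioi 0).indicator φ =ᶠ[nhds w] φ := fun w hw =>
    Filter.eventuallyEq_of_mem (Ioi_mem_nhds hw) fun _ hx => Set.indicator_of_mem hx φ
  refine ⟨?_, fun w => Set.indicator_nonneg (fun w hw => hnonneg w hw) w, fun w => ?_, by simp,
    fun w hw => (hdiff w hw).congr_of_eventuallyEq (heq w hw), fun w hw => ?_⟩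
  · rw [← Set.piecewise_eq_indicator]
    exact ContinuousOn.measurable_piecewise
      (fun w hw => (hdiff w hw).continuousAt.continuousWithinAt) continuousOn_const
      measurableSet_Ioi
  · by_cases hw : w ∈ Set.Ioi (0 : ℝ)
    · rw [Set.indicator_of_mem hw]
      exact hle w hw
    · rw [Set.indicator_of_notMem hw]
      exact (hnonneg 1 one_pos).trans (hle 1 one_pos)
  · rw [(heq w hw).deriv_eq]
    exact hincr w hw

/-- Theorem 2.1: in the canonical model where `(X, Z) ∈ ℝ^p × ℝ^n` has joint density
`(∏ d_i^{-1/2}) σ^{-p-n} f(((x−θ)ᵀD^{-1}(x−θ) + zᵀz)/σ²)`, the shrinkage estimator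
`θ̂_φ = (I − (φ(W)/W) C^{-1}) X`, where `W = XᵀC^{-1}D^{-1}X/S` and `S = ZᵀZ`,
dominates the least squares estimator `X` under the loss
`L_j(δ,θ,σ²) = (δ−θ)ᵀD^{-j}(δ−θ)/σ²`, provided `φ` is nondecreasing, differentiable, and
`0 ≤ φ(w) ≤ (2/(n+2)) ((∑ d_i^{1−j}/c_i)/(max_i d_i^{1−j}/c_i) − 2)` for all `w > 0`
(assuming the risk integrals are finite). -/
theorem stmt_0
    (p n : ℕ) (hp : 0 < p) (hn : 0 < n) (j : ℕ)
    (d c : Fin p → ℝ)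
    (hd_pos : ∀ i, 0 < d i)
    (hd_mono : ∀ i k : Fin p, i ≤ k → d k ≤ d i)
    (hc : ∀ i, 1 ≤ c i)
    (f : ℝ → ℝ) (hf_nonneg : ∀ t, 0 ≤ f t) (hf_meas : Measurable f)
    (φ : ℝ → ℝ)
    (hφ_diff : ∀ w > (0:ℝ), DifferentiableAt ℝ φ w)
    (hφ_incr : ∀ w > (0:ℝ), 0 ≤ deriv φ w)
    (hφ_nonneg : ∀ w > (0:ℝ), 0 ≤ φ w)
    (hφ_bound : ∀ w > (0:ℝ), φ w ≤ 2 / ((n : ℝ) + 2) *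
      ((∑ i, d i ^ ((1 : ℝ) - j) / c i) /
        (univ.sup' (univ_nonempty_iff.mpr (Fin.pos_iff_nonempty.mp hp))
          (fun i => d i ^ ((1 : ℝ) - j) / c i)) - 2))
    (θ : Fin p → ℝ) (σ : ℝ) (hσ : 0 < σ)
    (dens : ((Fin p → ℝ) × (Fin n → ℝ)) → ℝ)
    (hdens : dens = fun q => (∏ i, (d i) ^ (-(1:ℝ)/2)) * σ ^ (-(p : ℝ) - n) *
      f (((∑ i, (q.1 i - θ i) ^ 2 / d i) + ∑ k, (q.2 k) ^ 2) / σ ^ 2))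
    (hnorm : ∫ q, dens q = 1)
    (est : ((Fin p → ℝ) × (Fin n → ℝ)) → Fin p → ℝ)
    (hest : est = fun q i =>
      (1 - φ ((∑ i', (q.1 i') ^ 2 / (c i' * d i')) / (∑ k, (q.2 k) ^ 2)) /
          ((∑ i', (q.1 i') ^ 2 / (c i' * d i')) / (∑ k, (q.2 k) ^ 2)) / c i) * q.1 i)
    (h_int_est : Integrable (fun q => (∑ i, (est q i - θ i) ^ 2 / d i ^ j) / σ ^ 2 * dens q))
    (h_int_ls : Integrable (fun q => (∑ i, (q.1 i - θ i) ^ 2 / d i ^ j) / σ ^ 2 * dens q)) :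
    ∫ q, (∑ i, (est q i - θ i) ^ 2 / d i ^ j) / σ ^ 2 * dens q ≤
      ∫ q, (∑ i, (q.1 i - θ i) ^ 2 / d i ^ j) / σ ^ 2 * dens q := by
  set K : ℝ := 2 / ((n : ℝ) + 2) * ((∑ i, d i ^ ((1 : ℝ) - j) / c i) /
    (univ.sup' (univ_nonempty_iff.mpr (Fin.pos_iff_nonempty.mp hp))
      (fun i => d i ^ ((1 : ℝ) - j) / c i)) - 2) with hKdef
  set M : ℝ := univ.sup' (univ_nonempty_iff.mpr (Fin.pos_iff_nonempty.mp hp))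
      (fun i => d i ^ ((1 : ℝ) - j) / c i) with hMdef
  have hc0 : ∀ i, 0 < c i := fun i => one_pos.trans_le (hc i)
  have hcd : ∀ i, 0 < (c * d) i := fun i => mul_pos (hc0 i) (hd_pos i)
  have hdj : ∀ i, 0 < d i ^ j := fun i => pow_pos (hd_pos i) j
  have hw_eq : ∀ i, d i ^ ((1 : ℝ) - j) / c i = d i * (1 / (c i * d i ^ j)) := fun i => by
    rw [Real.rpow_sub (hd_pos i), Real.rpow_one, Real.rpow_natCast]
    have := hc0 i
    have := hdj i
    field_simp
  have hM : ∀ i, d i * (1 / (c i * d i ^ j)) ≤ M := fun i => by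
    rw [← hw_eq]
    exact le_sup' (fun i => d i ^ ((1 : ℝ) - j) / c i) (mem_univ i)
  have hM0 : 0 < M := by
    refine lt_of_lt_of_le ?_ (hM ⟨0, hp⟩)
    have := hc0 ⟨0, hp⟩
    have := hdj ⟨0, hp⟩
    have := hd_pos ⟨0, hp⟩
    positivity
  have hK : K * (((n : ℝ) + 2) * M) ≤ 2 * (∑ i, d i * (1 / (c i * d i ^ j)) - 2 * M) := by
    simp_rw [hKdef, hw_eq]
    refine le_of_eq ?_
    field_simp
  have hsh := isShrinkage_indicator hφ_diff hφ_incr hφ_nonneg hφ_bound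
  set φ₀ : ℝ → ℝ := (Set.Ioi 0).indicator φ with hφ₀
  set A : ℝ := (∏ i, (d i) ^ (-(1:ℝ)/2)) * σ ^ (-(p : ℝ) - n) with hA
  have hA0 : 0 < A :=
    mul_pos (prod_pos fun i _ => Real.rpow_pos_of_pos (hd_pos i) _) (Real.rpow_pos_of_pos hσ _)
  have hdens' : ∀ q, dens q = A * f (radius d θ σ q) := fun q => by rw [hdens]; rfl
  have hdens0 : ∀ q, 0 ≤ dens q := fun q => by
    rw [hdens']
    exact mul_nonneg hA0.le (hf_nonneg _)
  have hdens_int : Integrable dens := by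
    by_contra h
    rw [integral_undef h] at hnorm
    exact zero_ne_one hnorm
  have h0 : Integrable fun q : (Fin p → ℝ) × (Fin n → ℝ) => f (radius d θ σ q) := by
    refine (hdens_int.const_mul A⁻¹).congr (Filter.Eventually.of_forall fun q => ?_)
    simp only [hdens']
    field_simp
  have h2 : ∀ i, Integrable fun q : (Fin p → ℝ) × (Fin n → ℝ) =>
      (q.1 i - θ i) ^ 2 * f (radius d θ σ q) := fun i => by
    refine (h_int_ls.const_mul (d i ^ j * σ ^ 2 / A)).mono'
      (Measurable.aestronglyMeasurable (by fun_prop)) (Filter.Eventually.of_forall fun q => ?_)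
    rw [Real.norm_of_nonneg (mul_nonneg (sq_nonneg _) (hf_nonneg _)), hdens']
    have h1 : (q.1 i - θ i) ^ 2 / d i ^ j ≤ ∑ i, (q.1 i - θ i) ^ 2 / d i ^ j :=
      single_le_sum (f := fun i => (q.1 i - θ i) ^ 2 / d i ^ j)
        (fun i _ => div_nonneg (sq_nonneg _) (hdj i).le) (mem_univ i)
    rw [div_le_iff₀ (hdj i)] at h1
    calc _ ≤ (∑ i, (q.1 i - θ i) ^ 2 / d i ^ j) * d i ^ j * f (radius d θ σ q) :=
          mul_le_mul_of_nonneg_right h1 (hf_nonneg _)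
      _ = _ := by field_simp
  have hφm := hsh.measurable
  have hW0 : ∀ q : (Fin p → ℝ) × (Fin n → ℝ), 0 ≤ quad (c * d) q.1 / sumSq q.2 := fun q =>
    div_nonneg (quad_nonneg hcd _) (sumSq_nonneg _)
  obtain ⟨ψ, hψ⟩ : ∃ ψ : ℝ → (Fin p → ℝ) × (Fin n → ℝ) → ℝ, ψ = fun ε q =>
    φ₀ (quad (c * d) q.1 / sumSq q.2) / (quad (c * d) q.1 / sumSq q.2 + ε) := ⟨_, rfl⟩
  have hest' : ∀ q i, est q i = q.1 i - ψ 0 q * q.1 i / c i := fun q i => by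
    have h : φ (quad (c * d) q.1 / sumSq q.2) / (quad (c * d) q.1 / sumSq q.2) = ψ 0 q := by
      simp only [hψ, add_zero, hφ₀]
      rcases (hW0 q).eq_or_lt with h | h
      · rw [← h]
        simp
      · rw [Set.indicator_of_mem (Set.mem_Ioi.2 h)]
    rw [← h, hest]
    simp only [quad, sumSq, Pi.mul_apply]
    ring
  have hreg : ∀ ε, 0 < ε →
      ∫ q, (∑ i, (q.1 i - ψ ε q * q.1 i / c i - θ i) ^ 2 / d i ^ j) / σ ^ 2 * dens q ≤
        ∫ q, (∑ i, (q.1 i - θ i) ^ 2 / d i ^ j) / σ ^ 2 * dens q := fun ε hε => by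
    obtain ⟨hI1, hI2, hle⟩ := regularized_risk_le (w := fun i => 1 / (c i * d i ^ j)) hsh hε hp
      hd_pos hc0 hσ hf_meas hf_nonneg
      (fun i => one_div_nonneg.2 (mul_nonneg (hc0 i).le (hdj i).le)) hM hK h0 h2
    have hexp : ∀ q, (∑ i, (q.1 i - ψ ε q * q.1 i / c i - θ i) ^ 2 / d i ^ j) / σ ^ 2 * dens q =
        (∑ i, (q.1 i - θ i) ^ 2 / d i ^ j) / σ ^ 2 * dens q + A / σ ^ 2 *
        (ψ ε q ^ 2 * (∑ i, d i * (1 / (c i * d i ^ j)) * (q.1 i ^ 2 / (c * d) i)) *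
          f (radius d θ σ q) - 2 * ((∑ i, 1 / (c i * d i ^ j) * ((q.1 i - θ i) *
            (q.1 i * ψ ε q))) * f (radius d θ σ q))) := fun q => by
      have hs : ∑ i, (q.1 i - ψ ε q * q.1 i / c i - θ i) ^ 2 / d i ^ j =
          ∑ i, (q.1 i - θ i) ^ 2 / d i ^ j +
          (ψ ε q ^ 2 * (∑ i, d i * (1 / (c i * d i ^ j)) * (q.1 i ^ 2 / (c * d) i)) -
            2 * ∑ i, 1 / (c i * d i ^ j) * ((q.1 i - θ i) * (q.1 i * ψ ε q))) := by
        rw [mul_sum, mul_sum, ← sum_sub_distrib, ← sum_add_distrib]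
        refine sum_congr rfl fun i _ => ?_
        have h1 := hc0 i
        have h2 := hdj i
        have h3 := hd_pos i
        rw [Pi.mul_apply]
        field_simp
        ring
      rw [hs, hdens']
      ring
    have hψ' : ∀ q : (Fin p → ℝ) × (Fin n → ℝ), φ₀ (quad (c * d) q.1 / sumSq q.2) /
        (quad (c * d) q.1 / sumSq q.2 + ε) = ψ ε q := fun q => by rw [hψ]
    simp only [hψ'] at hI1 hI2 hle
    simp only [hexp]
    have hI3 := (hI2.sub (hI1.const_mul 2)).const_mul (A / σ ^ 2)
    simp only [Pi.sub_apply] at hI3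
    rw [integral_add h_int_ls hI3, integral_const_mul,
      integral_sub hI2 (hI1.const_mul 2), integral_const_mul]
    have : 0 ≤ A / σ ^ 2 := by positivity
    nlinarith
  have hlim : Filter.Tendsto (fun m : ℕ => ∫ q,
      (∑ i, (q.1 i - ψ (1 / ((m : ℝ) + 1)) q * q.1 i / c i - θ i) ^ 2 / d i ^ j) / σ ^ 2 * dens q)
      Filter.atTop (nhds (∫ q, (∑ i, (est q i - θ i) ^ 2 / d i ^ j) / σ ^ 2 * dens q)) := by
    refine tendsto_integral_of_dominated_convergence _ (fun m => ?_) (h_int_ls.add h_int_est)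
      (fun m => Filter.Eventually.of_forall fun q => ?_) (Filter.Eventually.of_forall fun q => ?_)
    · simp_rw [hdens', hψ]
      exact Measurable.aestronglyMeasurable (by fun_prop)
    · have hε : 0 < 1 / ((m : ℝ) + 1) := Nat.one_div_pos_of_nat
      generalize 1 / ((m : ℝ) + 1) = ε at *
      have hs : ∀ θ' : Fin p → ℝ, 0 ≤ ∑ i, (θ' i - θ i) ^ 2 / d i ^ j := fun θ' =>
        sum_nonneg fun i _ => div_nonneg (sq_nonneg _) (hdj i).le
      rw [Real.norm_of_nonneg (mul_nonneg (div_nonneg (hs fun i => q.1 i - ψ ε q * q.1 i / c i)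
        (sq_nonneg _)) (hdens0 q)), Pi.add_apply, ← add_mul, ← add_div, ← sum_add_distrib]
      refine mul_le_mul_of_nonneg_right (div_le_div_of_nonneg_right ?_ (sq_nonneg _)) (hdens0 q)
      refine sum_le_sum fun i _ => ?_
      rw [← add_div]
      refine div_le_div_of_nonneg_right ?_ (hdj i).le
      obtain ⟨ρ, hρ0, hρ1, hρ⟩ : ∃ ρ : ℝ, 0 ≤ ρ ∧ ρ ≤ 1 ∧ ψ ε q = ρ * ψ 0 q := by
        have hW := hW0 q
        simp only [hψ]
        generalize quad (c * d) q.1 / sumSq q.2 = v at *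
        rcases hW.eq_or_lt with rfl | hW
        · exact ⟨0, le_rfl, zero_le_one, by simp [hsh.map_zero]⟩
        · refine ⟨v / (v + ε), by positivity, (div_le_one (by positivity)).2 (by linarith), ?_⟩
          rw [add_zero]
          field_simp
      rw [hest', hρ]
      have hconv : ∀ a b : ℝ, (a - ρ * b) ^ 2 ≤ a ^ 2 + (a - b) ^ 2 := fun a b => by
        nlinarith [mul_nonneg (mul_nonneg hρ0 (sub_nonneg.2 hρ1)) (sq_nonneg b),
          mul_nonneg hρ0 (sq_nonneg a), mul_nonneg (sub_nonneg.2 hρ1) (sq_nonneg (a - b))]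
      have := hconv (q.1 i - θ i) (ψ 0 q * q.1 i / c i)
      refine (le_of_eq ?_).trans (this.trans_eq ?_) <;> ring
    · have hψlim : Filter.Tendsto (fun m : ℕ => ψ (1 / ((m : ℝ) + 1)) q) Filter.atTop
          (nhds (ψ 0 q)) := by
        have hW := hW0 q
        simp only [hψ]
        generalize quad (c * d) q.1 / sumSq q.2 = v at *
        rcases hW.eq_or_lt with rfl | hW
        · simp [hsh.map_zero]
        · exact (tendsto_const_nhds).div (tendsto_const_nhds.add
            tendsto_one_div_add_atTop_nhds_zero_nat) (by positivity)
      simp_rw [hest']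
      refine Filter.Tendsto.mul_const _ (Filter.Tendsto.div_const
        (tendsto_finsetSum _ fun i _ => ?_) _)
      exact (((tendsto_const_nhds.sub
        ((hψlim.mul_const _).div_const _)).sub_const _).pow 2).div_const _
  exact le_of_tendsto' hlim fun m => hreg _ Nat.one_div_pos_of_nat
end

section
/- Let φ_GB(w) = [w ∫₀¹ t^{p/2+a+1}(1−t)^b (1+wt/γ)^{−p/2−n/2−e−2} dt] / [γ ∫₀¹ t^{p/2+a}(1−t)^b (1+wt/γ)^{−p/2−n/2−e−2} dt]. If b ≥ 0, e > −p/2 − n/2 − 2 and −p/2 − 1 < a < n/2 + e, then φ_GB(w) is monotone nondecreasing in w on (0, ∞). -/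
open MeasureTheory Filter

/-- If `f₂ / f₁` is nondecreasing on `(0, v₁)` and `f₁` is supported there, then the mean of the
density `f₁` on `(0, v₁)` is at most the mean of the density `f₂` on `(0, v₂)`. -/
theorem mean_le_mean_of_monotone_likelihood_ratio {f₁ f₂ : ℝ → ℝ} {v₁ v₂ : ℝ} (hv₁ : 0 < v₁)
    (hv : v₁ ≤ v₂) (hf₁ : IntervalIntegrable f₁ volume 0 v₁)
    (hf₂ : IntervalIntegrable f₂ volume 0 v₂) (hpos₁ : ∀ u ∈ Set.Ioo 0 v₁, 0 < f₁ u)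
    (hpos₂ : ∀ u ∈ Set.Ioo 0 v₂, 0 < f₂ u)
    (hratio : ∀ s ∈ Set.Ioo 0 v₁, ∀ u ∈ Set.Ioo 0 v₁, s ≤ u → f₁ u * f₂ s ≤ f₁ s * f₂ u) :
    (∫ u in (0 : ℝ)..v₁, u * f₁ u) / (∫ u in (0 : ℝ)..v₁, f₁ u) ≤
      (∫ u in (0 : ℝ)..v₂, u * f₂ u) / (∫ u in (0 : ℝ)..v₂, f₂ u) := by
  have integrable_mul {f : ℝ → ℝ} {x y : ℝ} (hf : IntervalIntegrable f volume x y)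
      {g : ℝ → ℝ} (hg : Continuous g) : IntervalIntegrable (fun u => g u * f u) volume x y :=
    hf.continuousOn_mul hg.continuousOn
  have integral_centered {f : ℝ → ℝ} {x y : ℝ} (hf : IntervalIntegrable f volume x y) (m : ℝ) :
      ∫ u in x..y, (u - m) * f u = (∫ u in x..y, u * f u) - m * ∫ u in x..y, f u := by
    rw [← intervalIntegral.integral_const_mul,
      ← intervalIntegral.integral_sub (integrable_mul hf (g := fun u => u) continuous_id)
        (hf.const_mul m)]
    simp only [sub_mul]
  have hD₁ := intervalIntegral.intervalIntegral_pos_of_pos_on hf₁ hpos₁ hv₁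
  have hD₂ := intervalIntegral.intervalIntegral_pos_of_pos_on hf₂ hpos₂ (hv₁.trans_le hv)
  set m := (∫ u in (0 : ℝ)..v₁, u * f₁ u) / (∫ u in (0 : ℝ)..v₁, f₁ u) with hm
  have hcentered : ∫ u in (0 : ℝ)..v₁, (u - m) * f₁ u = 0 := by
    rw [integral_centered hf₁, hm, div_mul_cancel₀ _ hD₁.ne', sub_self]
  have hm_mem : m ∈ Set.Ioo 0 v₁ := by
    constructor
    · exact div_pos (intervalIntegral.intervalIntegral_pos_of_pos_on
        (integrable_mul hf₁ continuous_id) (fun u hu => mul_pos hu.1 (hpos₁ u hu)) hv₁) hD₁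
    · have h := intervalIntegral.intervalIntegral_pos_of_pos_on
        (integrable_mul hf₁ (g := fun u => v₁ - u) (continuous_const.sub continuous_id))
        (fun u hu => mul_pos (sub_pos.2 hu.2) (hpos₁ u hu)) hv₁
      have h' : ∫ u in (0 : ℝ)..v₁, (v₁ - u) * f₁ u =
          -∫ u in (0 : ℝ)..v₁, (u - v₁) * f₁ u := by
        rw [← intervalIntegral.integral_neg]
        congr 1 with u
        ring
      rw [h', integral_centered hf₁] at h
      rw [hm, div_lt_iff₀ hD₁]
      linarith
  have hf₂_left : IntervalIntegrable f₂ volume 0 v₁ := hf₂.mono_set (by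
    rw [Set.uIcc_of_le hv₁.le, Set.uIcc_of_le (hv₁.le.trans hv)]
    exact Set.Icc_subset_Icc_right hv)
  have hf₂_right : IntervalIntegrable f₂ volume v₁ v₂ := hf₂.mono_set (by
    rw [Set.uIcc_of_le hv, Set.uIcc_of_le (hv₁.le.trans hv)]
    exact Set.Icc_subset_Icc_left hv₁.le)
  have hcont : Continuous fun u : ℝ => u - m := continuous_id.sub continuous_const
  have hleft : 0 ≤ ∫ u in (0 : ℝ)..v₁, (u - m) * f₂ u := by
    have h : ∫ u in (0 : ℝ)..v₁, f₂ m * ((u - m) * f₁ u) ≤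
        ∫ u in (0 : ℝ)..v₁, f₁ m * ((u - m) * f₂ u) := by
      refine intervalIntegral.integral_mono_on_of_le_Ioo hv₁.le
        ((integrable_mul hf₁ hcont).const_mul _)
        ((integrable_mul hf₂_left hcont).const_mul _) fun u hu => ?_
      rcases le_total m u with h | h
      · nlinarith [mul_le_mul_of_nonneg_left (hratio m hm_mem u hu h) (sub_nonneg.2 h)]
      · nlinarith [mul_le_mul_of_nonneg_left (hratio u hu m hm_mem h) (sub_nonneg.2 h)]
    rw [intervalIntegral.integral_const_mul, intervalIntegral.integral_const_mul, hcentered,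
      mul_zero] at h
    exact nonneg_of_mul_nonneg_right h (hpos₁ m hm_mem)
  have hright : 0 ≤ ∫ u in v₁..v₂, (u - m) * f₂ u := by
    have h := intervalIntegral.integral_mono_on_of_le_Ioo hv
      (intervalIntegrable_const (c := (0 : ℝ))) (integrable_mul hf₂_right hcont) fun u hu =>
        mul_nonneg (sub_nonneg.2 (hm_mem.2.le.trans hu.1.le))
          (hpos₂ u ⟨hv₁.trans hu.1, hu.2⟩).le
    simpa using h
  have htotal := intervalIntegral.integral_add_adjacent_intervals
    (integrable_mul hf₂_left hcont) (integrable_mul hf₂_right hcont)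
  rw [integral_centered hf₂] at htotal
  rw [le_div_iff₀ hD₂]
  linarith

/-- The unnormalized density `u ^ α * (1 - u / v) ^ b * (1 + u) ^ r` of a generalized beta
distribution on `(0, v)`. -/
noncomputable def genBetaDensity (α b r v u : ℝ) : ℝ :=
  u ^ α * (1 - u / v) ^ b * (1 + u) ^ r

theorem genBetaDensity_pos {α b r v u : ℝ} (hu : u ∈ Set.Ioo 0 v) :
    0 < genBetaDensity α b r v u := by
  have hv : 0 < v := hu.1.trans hu.2
  have h₁ : 0 < 1 - u / v := sub_pos.2 ((div_lt_one hv).2 hu.2)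
  have h₂ : 0 < 1 + u := add_pos one_pos hu.1
  exact mul_pos (mul_pos (Real.rpow_pos_of_pos hu.1 α) (Real.rpow_pos_of_pos h₁ b))
    (Real.rpow_pos_of_pos h₂ r)

theorem genBetaDensity_mul_le {α b r v₁ v₂ s u : ℝ} (hb : 0 ≤ b) (hv : v₁ ≤ v₂)
    (hs : s ∈ Set.Ioo 0 v₁) (hu : u ∈ Set.Ioo 0 v₁) (hsu : s ≤ u) :
    genBetaDensity α b r v₁ u * genBetaDensity α b r v₂ s ≤
      genBetaDensity α b r v₁ s * genBetaDensity α b r v₂ u := by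
  have hv₁ : 0 < v₁ := hs.1.trans hs.2
  have hv₂ : 0 < v₂ := hv₁.trans_le hv
  have factor_nonneg {v x : ℝ} (hv₀ : 0 < v) (hx : x ≤ v) : 0 ≤ 1 - x / v :=
    sub_nonneg.2 ((div_le_one hv₀).2 hx)
  have hu₁ := factor_nonneg hv₁ hu.2.le
  have hs₁ := factor_nonneg hv₁ hs.2.le
  have hu₂ := factor_nonneg hv₂ (hu.2.le.trans hv)
  have hs₂ := factor_nonneg hv₂ (hs.2.le.trans hv)
  have hbase : (1 - u / v₁) * (1 - s / v₂) ≤ (1 - s / v₁) * (1 - u / v₂) := by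
    have hinv : v₂⁻¹ ≤ v₁⁻¹ := inv_anti₀ hv₁ hv
    simp only [div_eq_mul_inv]
    nlinarith [mul_nonneg (sub_nonneg.2 hsu) (sub_nonneg.2 hinv)]
  have hpow : (1 - u / v₁) ^ b * (1 - s / v₂) ^ b ≤ (1 - s / v₁) ^ b * (1 - u / v₂) ^ b := by
    rw [← Real.mul_rpow hu₁ hs₂, ← Real.mul_rpow hs₁ hu₂]
    exact Real.rpow_le_rpow (mul_nonneg hu₁ hs₂) hbase hb
  have hcoeff : 0 ≤ u ^ α * s ^ α * ((1 + u) ^ r * (1 + s) ^ r) := by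
    have := hu.1
    have := hs.1
    positivity
  unfold genBetaDensity
  calc
    _ = u ^ α * s ^ α * ((1 + u) ^ r * (1 + s) ^ r) *
        ((1 - u / v₁) ^ b * (1 - s / v₂) ^ b) := by ring
    _ ≤ u ^ α * s ^ α * ((1 + u) ^ r * (1 + s) ^ r) *
        ((1 - s / v₁) ^ b * (1 - u / v₂) ^ b) := mul_le_mul_of_nonneg_left hpow hcoeff
    _ = _ := by ring

theorem genBetaDensity_comp_mul {α b r v t : ℝ} (hv : 0 < v) (ht : 0 ≤ t) :
    genBetaDensity α b r v (v * t) = v ^ α * (t ^ α * (1 - t) ^ b * (1 + v * t) ^ r) := by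
  rw [genBetaDensity, Real.mul_rpow hv.le ht, mul_div_cancel_left₀ _ hv.ne']
  ring

theorem intervalIntegrable_genBetaDensity {α b r v : ℝ} (hv : 0 < v)
    (h : IntervalIntegrable (fun t => t ^ α * (1 - t) ^ b * (1 + v * t) ^ r) volume 0 1) :
    IntervalIntegrable (genBetaDensity α b r v) volume 0 v := by
  rw [← IntervalIntegrable.comp_mul_left_iff hv.ne', zero_div, div_self hv.ne']
  refine (h.const_mul (v ^ α)).congr_uIoo fun t ht => ?_
  rw [Set.uIoo_of_le zero_le_one] at ht
  exact (genBetaDensity_comp_mul hv ht.1.le).symm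

/-- Rescaling `u = v * t` expresses the ratio of beta-type integrals as a mean. -/
theorem ratio_eq_mean_genBetaDensity {α b r v : ℝ} (hv : 0 < v) :
    v * (∫ t in (0 : ℝ)..1, t ^ (α + 1) * (1 - t) ^ b * (1 + v * t) ^ r) /
        (∫ t in (0 : ℝ)..1, t ^ α * (1 - t) ^ b * (1 + v * t) ^ r) =
      (∫ u in (0 : ℝ)..v, u * genBetaDensity α b r v u) /
        (∫ u in (0 : ℝ)..v, genBetaDensity α b r v u) := by
  have hden : ∫ u in (0 : ℝ)..v, genBetaDensity α b r v u =
      v * (v ^ α * ∫ t in (0 : ℝ)..1, t ^ α * (1 - t) ^ b * (1 + v * t) ^ r) := by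
    have h := intervalIntegral.smul_integral_comp_mul_left
      (a := 0) (b := 1) (genBetaDensity α b r v) v
    rw [mul_zero, mul_one, smul_eq_mul] at h
    rw [← h]
    congr 1
    rw [← intervalIntegral.integral_const_mul]
    exact intervalIntegral.integral_congr_Ioo_of_le zero_le_one fun t ht =>
      genBetaDensity_comp_mul hv ht.1.le
  have hnum : ∫ u in (0 : ℝ)..v, u * genBetaDensity α b r v u =
      v * (v ^ α * (v * ∫ t in (0 : ℝ)..1, t ^ (α + 1) * (1 - t) ^ b * (1 + v * t) ^ r)) := by
    have h := intervalIntegral.smul_integral_comp_mul_left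
      (a := 0) (b := 1) (fun u => u * genBetaDensity α b r v u) v
    rw [mul_zero, mul_one, smul_eq_mul] at h
    rw [← h]
    congr 1
    rw [← mul_assoc, ← intervalIntegral.integral_const_mul]
    refine intervalIntegral.integral_congr_Ioo_of_le zero_le_one fun t ht => ?_
    simp only [genBetaDensity_comp_mul hv ht.1.le, Real.rpow_add_one ht.1.ne']
    ring
  rw [hden, hnum, mul_div_mul_left _ _ hv.ne',
    mul_div_mul_left _ _ (Real.rpow_pos_of_pos hv α).ne']

/-- Lemma 2.2(i): with
`φ_GB(w) = [w ∫₀¹ t^{p/2+a+1}(1−t)^b (1+wt/γ)^{−p/2−n/2−e−2} dt]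
            / [γ ∫₀¹ t^{p/2+a}(1−t)^b (1+wt/γ)^{−p/2−n/2−e−2} dt]`,
if `b ≥ 0`, `e > −p/2 − n/2 − 2` and `−p/2 − 1 < a < n/2 + e`, then
`φ_GB` is monotone nondecreasing on `(0, ∞)`. -/
theorem stmt_1 (p n : ℕ) (hp : 0 < p) (hn : 0 < n) (a b e γ : ℝ)
    (hγ : 1 ≤ γ) (hb : 0 ≤ b) (he : -(p : ℝ) / 2 - (n : ℝ) / 2 - 2 < e)
    (ha₁ : -(p : ℝ) / 2 - 1 < a) (ha₂ : a < (n : ℝ) / 2 + e)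
    (hint : ∀ w > (0 : ℝ),
      IntervalIntegrable (fun t => t ^ ((p : ℝ) / 2 + a + 1) * (1 - t) ^ b *
        (1 + w * t / γ) ^ (-(p : ℝ) / 2 - (n : ℝ) / 2 - e - 2)) volume 0 1 ∧
      IntervalIntegrable (fun t => t ^ ((p : ℝ) / 2 + a) * (1 - t) ^ b *
        (1 + w * t / γ) ^ (-(p : ℝ) / 2 - (n : ℝ) / 2 - e - 2)) volume 0 1)
    (φGB : ℝ → ℝ)
    (hφGB : ∀ w, φGB w =
      (w * ∫ t in (0:ℝ)..1, t ^ ((p : ℝ) / 2 + a + 1) * (1 - t) ^ b *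
        (1 + w * t / γ) ^ (-(p : ℝ) / 2 - (n : ℝ) / 2 - e - 2)) /
      (γ * ∫ t in (0:ℝ)..1, t ^ ((p : ℝ) / 2 + a) * (1 - t) ^ b *
        (1 + w * t / γ) ^ (-(p : ℝ) / 2 - (n : ℝ) / 2 - e - 2))) :
    MonotoneOn φGB (Set.Ioi 0) := by
  have hγ₀ : 0 < γ := one_pos.trans_le hγ
  have hscale (w t : ℝ) : w * t / γ = w / γ * t := by ring
  simp only [hscale] at hint hφGB
  have hmean (w : ℝ) (hw : 0 < w) := ratio_eq_mean_genBetaDensity (α := (p : ℝ) / 2 + a)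
    (b := b) (r := -(p : ℝ) / 2 - (n : ℝ) / 2 - e - 2) (div_pos hw hγ₀)
  intro w₁ hw₁ w₂ hw₂ hw
  have hv₁ : 0 < w₁ / γ := div_pos hw₁ hγ₀
  have hv₂ : 0 < w₂ / γ := div_pos hw₂ hγ₀
  have hv : w₁ / γ ≤ w₂ / γ := div_le_div_of_nonneg_right hw hγ₀.le
  rw [hφGB, hφGB, mul_div_mul_comm, ← mul_div_assoc, hmean w₁ hw₁, mul_div_mul_comm,
    ← mul_div_assoc, hmean w₂ hw₂]
  exact mean_le_mean_of_monotone_likelihood_ratio hv₁ hv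
    (intervalIntegrable_genBetaDensity hv₁ (hint w₁ hw₁).2)
    (intervalIntegrable_genBetaDensity hv₂ (hint w₂ hw₂).2)
    (fun _ => genBetaDensity_pos) (fun _ => genBetaDensity_pos)
    fun _ hs _ hu => genBetaDensity_mul_le hb hv hs hu
end

section
/- Let φ_GB(w) = [w ∫₀¹ t^{p/2+a+1}(1−t)^b (1+wt/γ)^{−p/2−n/2−e−2} dt] / [γ ∫₀¹ t^{p/2+a}(1−t)^b (1+wt/γ)^{−p/2−n/2−e−2} dt]. If b ≥ 0, e > −p/2 − n/2 − 2 and −p/2 − 1 < a < n/2 + e, then the function w ↦ φ_GB(w)/w is monotone nonincreasing on (0, ∞). -/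
open MeasureTheory Filter

/-- Reweighting a density `g₁` on `[0, 1]` by an antitone factor `h` does not increase its mean. -/
theorem mean_reweight_le_of_antitoneOn {g₁ g₂ h : ℝ → ℝ}
    (hg₁ : IntervalIntegrable g₁ volume 0 1) (hg₂ : IntervalIntegrable g₂ volume 0 1)
    (hpos₁ : ∀ t ∈ Set.Ioo (0 : ℝ) 1, 0 < g₁ t)
    (hnn₁ : ∀ t ∈ Set.Icc (0 : ℝ) 1, 0 ≤ g₁ t) (hnn₂ : ∀ t ∈ Set.Icc (0 : ℝ) 1, 0 ≤ g₂ t)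
    (hh : AntitoneOn h (Set.Ici 0)) (hgh : ∀ t ∈ Set.Icc (0 : ℝ) 1, g₂ t = h t * g₁ t) :
    (∫ t in (0 : ℝ)..1, t * g₂ t) / (∫ t in (0 : ℝ)..1, g₂ t) ≤
      (∫ t in (0 : ℝ)..1, t * g₁ t) / (∫ t in (0 : ℝ)..1, g₁ t) := by
  have hm₁ : IntervalIntegrable (fun t => t * g₁ t) volume 0 1 :=
    hg₁.continuousOn_mul continuousOn_id
  have hm₂ : IntervalIntegrable (fun t => t * g₂ t) volume 0 1 :=
    hg₂.continuousOn_mul continuousOn_id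
  have hD₁ : 0 < ∫ t in (0 : ℝ)..1, g₁ t :=
    intervalIntegral.intervalIntegral_pos_of_pos_on hg₁ hpos₁ one_pos
  have hD₂ : 0 ≤ ∫ t in (0 : ℝ)..1, g₂ t :=
    intervalIntegral.integral_nonneg zero_le_one hnn₂
  have hN₁ : 0 ≤ ∫ t in (0 : ℝ)..1, t * g₁ t :=
    intervalIntegral.integral_nonneg zero_le_one fun t ht => mul_nonneg ht.1 (hnn₁ t ht)
  set c := (∫ t in (0 : ℝ)..1, t * g₁ t) / (∫ t in (0 : ℝ)..1, g₁ t) with hc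
  have hc0 : 0 ≤ c := div_nonneg hN₁ hD₁.le
  have hcD : c * (∫ t in (0 : ℝ)..1, g₁ t) = ∫ t in (0 : ℝ)..1, t * g₁ t :=
    div_mul_cancel₀ _ hD₁.ne'
  have key : (∫ t in (0 : ℝ)..1, (t * g₂ t - c * g₂ t)) ≤
      ∫ t in (0 : ℝ)..1, h c * (t * g₁ t - c * g₁ t) := by
    refine intervalIntegral.integral_mono_on zero_le_one (hm₂.sub (hg₂.const_mul c))
      ((hm₁.sub (hg₁.const_mul c)).const_mul (h c)) fun t ht => ?_
    have hsign : (t - c) * (h t - h c) ≤ 0 := by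
      rcases le_total t c with htc | htc
      · exact mul_nonpos_of_nonpos_of_nonneg (sub_nonpos.2 htc)
          (sub_nonneg.2 (hh (Set.mem_Ici.2 ht.1) hc0 htc))
      · exact mul_nonpos_of_nonneg_of_nonpos (sub_nonneg.2 htc)
          (sub_nonpos.2 (hh hc0 (Set.mem_Ici.2 ht.1) htc))
    rw [hgh t ht]
    linarith [mul_nonpos_of_nonpos_of_nonneg hsign (hnn₁ t ht)]
  rw [intervalIntegral.integral_const_mul, intervalIntegral.integral_sub hm₂ (hg₂.const_mul c),
    intervalIntegral.integral_sub hm₁ (hg₁.const_mul c), intervalIntegral.integral_const_mul,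
    intervalIntegral.integral_const_mul, hcD, sub_self, mul_zero, sub_nonpos] at key
  exact div_le_of_le_mul₀ hD₂ hc0 key

/-- The ratio `(1 + v t) / (1 + u t)` with `0 ≤ u ≤ v`, raised to a nonpositive power, is
antitone in `t ≥ 0`. -/
theorem antitoneOn_linear_ratio_rpow {u v q : ℝ} (hu : 0 ≤ u) (huv : u ≤ v) (hq : q ≤ 0) :
    AntitoneOn (fun t : ℝ => ((1 + v * t) / (1 + u * t)) ^ q) (Set.Ici 0) := by
  intro s hs t ht hst
  have hs : 0 ≤ s := hs
  have ht : 0 ≤ t := ht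
  have hv : 0 ≤ v := hu.trans huv
  refine Real.rpow_le_rpow_of_nonpos (by positivity) ?_ hq
  rw [div_le_div_iff₀ (by positivity) (by positivity)]
  linarith [mul_nonneg (sub_nonneg.2 huv) (sub_nonneg.2 hst)]

/-- Lemma 2.2(ii): with
`φ_GB(w) = [w ∫₀¹ t^{p/2+a+1}(1−t)^b (1+wt/γ)^{−p/2−n/2−e−2} dt]
            / [γ ∫₀¹ t^{p/2+a}(1−t)^b (1+wt/γ)^{−p/2−n/2−e−2} dt]`,
if `b ≥ 0`, `e > −p/2 − n/2 − 2` and `−p/2 − 1 < a < n/2 + e`, then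
`w ↦ φ_GB(w)/w` is monotone nonincreasing on `(0, ∞)`. -/
theorem stmt_2 (p n : ℕ) (hp : 0 < p) (hn : 0 < n) (a b e γ : ℝ)
    (hγ : 1 ≤ γ) (hb : 0 ≤ b) (he : -(p : ℝ) / 2 - (n : ℝ) / 2 - 2 < e)
    (ha₁ : -(p : ℝ) / 2 - 1 < a) (ha₂ : a < (n : ℝ) / 2 + e)
    (hint : ∀ w > (0 : ℝ),
      IntervalIntegrable (fun t => t ^ ((p : ℝ) / 2 + a + 1) * (1 - t) ^ b *
        (1 + w * t / γ) ^ (-(p : ℝ) / 2 - (n : ℝ) / 2 - e - 2)) volume 0 1 ∧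
      IntervalIntegrable (fun t => t ^ ((p : ℝ) / 2 + a) * (1 - t) ^ b *
        (1 + w * t / γ) ^ (-(p : ℝ) / 2 - (n : ℝ) / 2 - e - 2)) volume 0 1)
    (φGB : ℝ → ℝ)
    (hφGB : ∀ w, φGB w =
      (w * ∫ t in (0:ℝ)..1, t ^ ((p : ℝ) / 2 + a + 1) * (1 - t) ^ b *
        (1 + w * t / γ) ^ (-(p : ℝ) / 2 - (n : ℝ) / 2 - e - 2)) /
      (γ * ∫ t in (0:ℝ)..1, t ^ ((p : ℝ) / 2 + a) * (1 - t) ^ b *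
        (1 + w * t / γ) ^ (-(p : ℝ) / 2 - (n : ℝ) / 2 - e - 2))) :
    AntitoneOn (fun w => φGB w / w) (Set.Ioi 0) := by
  have hγ0 : 0 < γ := one_pos.trans_le hγ
  set q : ℝ := -(p : ℝ) / 2 - (n : ℝ) / 2 - e - 2 with hq
  set s : ℝ := (p : ℝ) / 2 + a with hs
  have hq0 : q ≤ 0 := by rw [hq]; linarith
  have hs0 : s + 1 ≠ 0 := by
    have : 0 < s + 1 := by rw [hs]; linarith
    exact this.ne'
  let g : ℝ → ℝ → ℝ := fun w t => t ^ s * (1 - t) ^ b * (1 + w * t / γ) ^ q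
  have hval : ∀ w > 0, φGB w / w =
      (∫ t in (0 : ℝ)..1, t * g w t) / (∫ t in (0 : ℝ)..1, g w t) / γ := by
    intro w hw
    have hnum : (∫ t in (0 : ℝ)..1, t ^ (s + 1) * (1 - t) ^ b * (1 + w * t / γ) ^ q) =
        ∫ t in (0 : ℝ)..1, t * g w t := by
      refine intervalIntegral.integral_congr fun t ht => ?_
      rw [Set.uIcc_of_le zero_le_one] at ht
      simp only [g]
      rw [Real.rpow_add_one' ht.1 hs0]
      ring
    rw [hφGB, hnum, mul_div_mul_comm, mul_comm (w / γ), mul_div_assoc, div_div,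
      mul_comm γ w, ← div_div, div_self hw.ne', mul_one_div]
  have hbase : ∀ w > 0, ∀ t, 0 ≤ t → 0 < 1 + w * t / γ := fun w hw t ht => by positivity
  have hnn : ∀ w > 0, ∀ t ∈ Set.Icc (0 : ℝ) 1, 0 ≤ g w t := fun w hw t ht =>
    mul_nonneg (mul_nonneg (Real.rpow_nonneg ht.1 _) (Real.rpow_nonneg (sub_nonneg.2 ht.2) _))
      (Real.rpow_nonneg (hbase w hw t ht.1).le _)
  intro u hu v hv huv
  have hu : 0 < u := hu
  have hv : 0 < v := hv
  simp only [hval u hu, hval v hv]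
  refine div_le_div_of_nonneg_right (mean_reweight_le_of_antitoneOn (hint u hu).2 (hint v hv).2
    (fun t ht => mul_pos (mul_pos (Real.rpow_pos_of_pos ht.1 _)
      (Real.rpow_pos_of_pos (sub_pos.2 ht.2) _))
      (Real.rpow_pos_of_pos (hbase u hu t ht.1.le) _)) (hnn u hu) (hnn v hv)
    (antitoneOn_linear_ratio_rpow (div_nonneg hu.le hγ0.le)
      (div_le_div_of_nonneg_right huv hγ0.le) hq0) fun t ht => ?_) hγ0.le
  have hut := hbase u hu t ht.1
  have hvt := hbase v hv t ht.1
  have hne := (Real.rpow_pos_of_pos hut q).ne'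
  simp only [g]
  rw [div_mul_eq_mul_div, div_mul_eq_mul_div, Real.div_rpow hvt.le hut.le]
  rw [mul_left_comm, div_mul_cancel₀ _ hne]
end

section
/- Let φ_GB(w) = [w ∫₀¹ t^{p/2+a+1}(1−t)^b (1+wt/γ)^{−p/2−n/2−e−2} dt] / [γ ∫₀¹ t^{p/2+a}(1−t)^b (1+wt/γ)^{−p/2−n/2−e−2} dt]. If b ≥ 0, e > −p/2 − n/2 − 2 and −p/2 − 1 < a < n/2 + e, then lim_{w→∞} φ_GB(w) = (p/2 + a + 1)/(n/2 + e − a). -/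
open MeasureTheory Filter

/-- The beta-prime kernel `u ^ s * (1 + u) ^ (-c)` is integrable on the positive half-line. -/
theorem integrableOn_rpow_mul_one_add_rpow_neg {s c : ℝ} (hs : -1 < s) (hc : s + 1 < c) :
    IntegrableOn (fun u : ℝ => u ^ s * (1 + u) ^ (-c)) (Set.Ioi 0) := by
  have hmeas : Measurable (fun u : ℝ => u ^ s * (1 + u) ^ (-c)) := by fun_prop
  rw [← Set.Ioc_union_Ioi_eq_Ioi zero_le_one]
  refine IntegrableOn.union ?_ ?_
  · have h := (intervalIntegral.intervalIntegrable_rpow' (a := 0) (b := 1) hs)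
    rw [intervalIntegrable_iff_integrableOn_Ioc_of_le zero_le_one] at h
    refine Integrable.mono' h hmeas.aestronglyMeasurable ?_
    filter_upwards [ae_restrict_mem measurableSet_Ioc] with u hu
    have hu0 : 0 < u := hu.1
    rw [Real.norm_of_nonneg (by positivity)]
    exact mul_le_of_le_one_right (by positivity)
      (Real.rpow_le_one_of_one_le_of_nonpos (by linarith) (by linarith))
  · have h := integrableOn_Ioi_rpow_of_lt (a := s + -c) (by linarith) zero_lt_one
    refine Integrable.mono' h hmeas.aestronglyMeasurable ?_
    filter_upwards [ae_restrict_mem measurableSet_Ioi] with u hu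
    have hu0 : 0 < u := zero_lt_one.trans hu
    rw [Real.norm_of_nonneg (by positivity), Real.rpow_add hu0]
    exact mul_le_mul_of_nonneg_left
      (Real.rpow_le_rpow_of_nonpos hu0 (by linarith) (by linarith)) (by positivity)

theorem integral_rpow_mul_one_add_rpow_neg_pos {s c : ℝ} (hs : -1 < s) (hc : s + 1 < c) :
    0 < ∫ u in Set.Ioi (0 : ℝ), u ^ s * (1 + u) ^ (-c) := by
  have hpos : ∀ u ∈ Set.Ioi (0 : ℝ), 0 < u ^ s * (1 + u) ^ (-c) := fun u hu => by
    have hu0 : 0 < u := hu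
    positivity
  rw [setIntegral_pos_iff_support_of_nonneg_ae
    ((ae_restrict_mem measurableSet_Ioi).mono fun u hu => (hpos u hu).le)
    (integrableOn_rpow_mul_one_add_rpow_neg hs hc),
    Set.inter_eq_right.2 fun u hu => Function.mem_support.2 (hpos u hu).ne']
  simp

/-- Recurrence for the beta-prime integral, by integration by parts. -/
theorem integral_rpow_mul_one_add_rpow_neg_recurrence {s c : ℝ} (hs : -1 < s) (hc : s + 2 < c) :
    (c - s - 2) * ∫ u in Set.Ioi (0 : ℝ), u ^ (s + 1) * (1 + u) ^ (-c) =
      (s + 1) * ∫ u in Set.Ioi (0 : ℝ), u ^ s * (1 + u) ^ (-c) := by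
  have hi₀ := integrableOn_rpow_mul_one_add_rpow_neg (s := s) (c := c) hs (by linarith)
  have hi₁ := integrableOn_rpow_mul_one_add_rpow_neg (s := s + 1) (c := c)
    (by linarith) (by linarith)
  have hderiv : ∀ u ∈ Set.Ioi (0 : ℝ),
      HasDerivAt (fun u : ℝ => u ^ (s + 1) * (1 + u) ^ (1 - c))
        ((s + 1) * (u ^ s * (1 + u) ^ (-c)) -
          (c - s - 2) * (u ^ (s + 1) * (1 + u) ^ (-c))) u := by
    intro u hu
    have hu0 : 0 < u := hu
    have h₁ := Real.hasDerivAt_rpow_const (x := u) (p := s + 1) (Or.inl hu0.ne')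
    have h₂ := ((hasDerivAt_id u).const_add 1).rpow_const (p := 1 - c)
      (Or.inl (by simp only [id]; positivity))
    refine (h₁.mul h₂).congr_deriv ?_
    have e₁ : (1 + u) ^ (1 - c) = (1 + u) * (1 + u) ^ (-c) := by
      rw [sub_eq_add_neg, Real.rpow_add (by positivity), Real.rpow_one]
    have e₂ : u ^ (s + 1) = u ^ s * u := by rw [Real.rpow_add hu0, Real.rpow_one]
    simp only [id, e₁, e₂, add_sub_cancel_right, show 1 - c - 1 = -c by ring]
    ring
  have hcont : ContinuousWithinAt (fun u : ℝ => u ^ (s + 1) * (1 + u) ^ (1 - c))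
      (Set.Ici 0) 0 := by
    refine ContinuousAt.continuousWithinAt (ContinuousAt.mul ?_ ?_)
    · exact Real.continuousAt_rpow_const _ _ (Or.inr (by linarith))
    · exact ContinuousAt.rpow_const (by fun_prop) (Or.inl (by norm_num))
  have hlim : Tendsto (fun u : ℝ => u ^ (s + 1) * (1 + u) ^ (1 - c)) atTop (nhds 0) := by
    have h := tendsto_rpow_neg_atTop (y := c - s - 2) (by linarith)
    refine squeeze_zero' ?_ ?_ h
    · filter_upwards [eventually_gt_atTop 0] with u hu
      positivity
    · filter_upwards [eventually_gt_atTop 0] with u hu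
      rw [show -(c - s - 2) = (s + 1) + (1 - c) by ring, Real.rpow_add hu (s + 1) (1 - c)]
      exact mul_le_mul_of_nonneg_left
        (Real.rpow_le_rpow_of_nonpos hu (by linarith) (by linarith)) (by positivity)
  have h := integral_Ioi_of_hasDerivAt_of_tendsto hcont hderiv
    ((hi₀.const_mul _).sub (hi₁.const_mul _)) hlim
  rw [integral_sub (hi₀.const_mul _) (hi₁.const_mul _), integral_const_mul, integral_const_mul,
    Real.zero_rpow (by linarith)] at h
  linarith

/-- Rescaling `u = v * t` in an incomplete beta-type integral. -/
theorem integral_rpow_mul_one_sub_rpow_mul_one_add_mul_rpow {s b c v : ℝ} (hv : 0 < v) :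
    ∫ t in (0 : ℝ)..1, t ^ s * (1 - t) ^ b * (1 + v * t) ^ (-c) =
      v ^ (-(s + 1)) * ∫ u in (0 : ℝ)..v, u ^ s * (1 - u / v) ^ b * (1 + u) ^ (-c) := by
  have h := intervalIntegral.integral_comp_mul_left (a := 0) (b := 1)
    (fun u : ℝ => u ^ s * (1 - u / v) ^ b * (1 + u) ^ (-c)) hv.ne'
  simp only [mul_zero, mul_one, smul_eq_mul] at h
  have e₁ : v ^ (-(s + 1)) = v ^ (-s) * v⁻¹ := by
    rw [neg_add, Real.rpow_add hv, Real.rpow_neg_one]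
  rw [e₁, mul_assoc, ← h, ← intervalIntegral.integral_const_mul]
  refine intervalIntegral.integral_congr fun t ht => ?_
  rw [Set.uIcc_of_le zero_le_one] at ht
  have e₂ : v ^ (-s) * v ^ s = 1 := by rw [← Real.rpow_add hv]; simp
  simp only [Real.mul_rpow hv.le ht.1, mul_div_cancel_left₀ _ hv.ne']
  linear_combination (-(t ^ s * (1 - t) ^ b * (1 + v * t) ^ (-c))) * e₂

theorem tendsto_integral_rpow_mul_one_sub_div_rpow_mul_one_add_rpow {s b c : ℝ}
    (hs : -1 < s) (hb : 0 ≤ b) (hc : s + 1 < c) :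
    Tendsto (fun v : ℝ => ∫ u in (0 : ℝ)..v, u ^ s * (1 - u / v) ^ b * (1 + u) ^ (-c)) atTop
      (nhds (∫ u in Set.Ioi (0 : ℝ), u ^ s * (1 + u) ^ (-c))) := by
  have key : Tendsto (fun v : ℝ => ∫ u in Set.Ioi (0 : ℝ), (Set.Ioc 0 v).indicator
      (fun u => u ^ s * (1 - u / v) ^ b * (1 + u) ^ (-c)) u) atTop
      (nhds (∫ u in Set.Ioi (0 : ℝ), u ^ s * (1 + u) ^ (-c))) := by
    refine tendsto_integral_filter_of_dominated_convergence _ ?_ ?_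
      (integrableOn_rpow_mul_one_add_rpow_neg hs hc) ?_
    · refine Eventually.of_forall fun v => Measurable.aestronglyMeasurable ?_
      exact Measurable.indicator (by fun_prop) measurableSet_Ioc
    · filter_upwards [eventually_gt_atTop 0] with v hv
      filter_upwards [ae_restrict_mem measurableSet_Ioi] with u hu
      have hu0 : 0 < u := hu
      by_cases huv : u ≤ v
      · have hdiv : u / v ≤ 1 := (div_le_one hv).2 huv
        have hdiv0 : 0 ≤ u / v := by positivity
        have hsub : 0 ≤ 1 - u / v := by linarith
        rw [Set.indicator_of_mem (Set.mem_Ioc.2 ⟨hu0, huv⟩),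
          Real.norm_of_nonneg (by positivity)]
        exact mul_le_mul_of_nonneg_right (mul_le_of_le_one_right (by positivity)
          (Real.rpow_le_one hsub (by linarith) hb)) (by positivity)
      · rw [Set.indicator_of_notMem fun h => huv h.2, norm_zero]
        positivity
    · filter_upwards [ae_restrict_mem measurableSet_Ioi] with u hu
      have hdiv : Tendsto (fun v : ℝ => 1 - u / v) atTop (nhds 1) := by
        simpa using (tendsto_const_nhds (x := (1 : ℝ))).sub (tendsto_id.const_div_atTop u)
      have hpow := hdiv.rpow_const (p := b) (Or.inl one_ne_zero)
      rw [Real.one_rpow] at hpow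
      have h := (hpow.const_mul (u ^ s)).mul_const ((1 + u) ^ (-c))
      rw [mul_one] at h
      refine h.congr' ?_
      filter_upwards [eventually_ge_atTop u] with v hv
      rw [Set.indicator_of_mem (Set.mem_Ioc.2 ⟨hu, hv⟩)]
  refine key.congr' ?_
  filter_upwards [eventually_gt_atTop 0] with v hv
  rw [setIntegral_indicator measurableSet_Ioc, intervalIntegral.integral_of_le hv.le,
    Set.inter_eq_right.2 Set.Ioc_subset_Ioi_self]

theorem tendsto_mul_integral_div_integral {s b c : ℝ}
    (hs : -1 < s) (hb : 0 ≤ b) (hc : s + 2 < c) :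
    Tendsto (fun v : ℝ =>
      (v * ∫ t in (0 : ℝ)..1, t ^ (s + 1) * (1 - t) ^ b * (1 + v * t) ^ (-c)) /
        ∫ t in (0 : ℝ)..1, t ^ s * (1 - t) ^ b * (1 + v * t) ^ (-c)) atTop
      (nhds ((s + 1) / (c - s - 2))) := by
  have hpos := integral_rpow_mul_one_add_rpow_neg_pos (s := s) (c := c) hs (by linarith)
  have hrec := integral_rpow_mul_one_add_rpow_neg_recurrence hs hc
  have h := (tendsto_integral_rpow_mul_one_sub_div_rpow_mul_one_add_rpow
    (s := s + 1) (b := b) (c := c) (by linarith) hb (by linarith)).div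
    (tendsto_integral_rpow_mul_one_sub_div_rpow_mul_one_add_rpow
      (s := s) (b := b) (c := c) hs hb (by linarith)) hpos.ne'
  have hval : (∫ u in Set.Ioi (0 : ℝ), u ^ (s + 1) * (1 + u) ^ (-c)) /
      (∫ u in Set.Ioi (0 : ℝ), u ^ s * (1 + u) ^ (-c)) = (s + 1) / (c - s - 2) := by
    rw [div_eq_div_iff hpos.ne' (by linarith)]
    linarith
  rw [hval] at h
  refine h.congr' ?_
  filter_upwards [eventually_gt_atTop 0] with v hv
  have hexp : v * v ^ (-(s + 1 + 1)) = v ^ (-(s + 1)) := by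
    rw [← Real.rpow_one_add' hv.le (by linarith)]
    congr 1
    ring
  rw [integral_rpow_mul_one_sub_rpow_mul_one_add_mul_rpow hv,
    integral_rpow_mul_one_sub_rpow_mul_one_add_mul_rpow hv, ← mul_assoc, hexp,
    mul_div_mul_left _ _ (Real.rpow_pos_of_pos hv _).ne']
  rfl


/-- Lemma 2.2(iii): with
`φ_GB(w) = [w ∫₀¹ t^{p/2+a+1}(1−t)^b (1+wt/γ)^{−p/2−n/2−e−2} dt]
            / [γ ∫₀¹ t^{p/2+a}(1−t)^b (1+wt/γ)^{−p/2−n/2−e−2} dt]`,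
if `b ≥ 0`, `e > −p/2 − n/2 − 2` and `−p/2 − 1 < a < n/2 + e`, then
`lim_{w→∞} φ_GB(w) = (p/2 + a + 1)/(n/2 + e − a)`. -/
theorem stmt_3 (p n : ℕ) (hp : 0 < p) (hn : 0 < n) (a b e γ : ℝ)
    (hγ : 1 ≤ γ) (hb : 0 ≤ b) (he : -(p : ℝ) / 2 - (n : ℝ) / 2 - 2 < e)
    (ha₁ : -(p : ℝ) / 2 - 1 < a) (ha₂ : a < (n : ℝ) / 2 + e)
    (hint : ∀ w > (0 : ℝ),
      IntervalIntegrable (fun t => t ^ ((p : ℝ) / 2 + a + 1) * (1 - t) ^ b *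
        (1 + w * t / γ) ^ (-(p : ℝ) / 2 - (n : ℝ) / 2 - e - 2)) volume 0 1 ∧
      IntervalIntegrable (fun t => t ^ ((p : ℝ) / 2 + a) * (1 - t) ^ b *
        (1 + w * t / γ) ^ (-(p : ℝ) / 2 - (n : ℝ) / 2 - e - 2)) volume 0 1)
    (φGB : ℝ → ℝ)
    (hφGB : ∀ w, φGB w =
      (w * ∫ t in (0:ℝ)..1, t ^ ((p : ℝ) / 2 + a + 1) * (1 - t) ^ b *
        (1 + w * t / γ) ^ (-(p : ℝ) / 2 - (n : ℝ) / 2 - e - 2)) /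
      (γ * ∫ t in (0:ℝ)..1, t ^ ((p : ℝ) / 2 + a) * (1 - t) ^ b *
        (1 + w * t / γ) ^ (-(p : ℝ) / 2 - (n : ℝ) / 2 - e - 2))) :
    Tendsto φGB atTop (nhds (((p : ℝ) / 2 + a + 1) / ((n : ℝ) / 2 + e - a))) := by
  have hγ0 : 0 < γ := by linarith
  have h := (tendsto_mul_integral_div_integral (s := (p : ℝ) / 2 + a) (b := b)
    (c := (p : ℝ) / 2 + n / 2 + e + 2) (by linarith) hb (by linarith)).comp
    (tendsto_id.atTop_div_const hγ0)
  rw [show (p : ℝ) / 2 + n / 2 + e + 2 - (p / 2 + a) - 2 = n / 2 + e - a by ring] at h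
  refine h.congr fun w => ?_
  simp only [Function.comp_apply, id, hφGB, div_mul_eq_mul_div,
    show -((p : ℝ) / 2 + n / 2 + e + 2) = -p / 2 - n / 2 - e - 2 by ring]
  rw [div_div]
end

section
/- Let φ_GB(w) = [w ∫₀¹ t^{p/2+a+1}(1−t)^b (1+wt/γ)^{−p/2−n/2−e−2} dt] / [γ ∫₀¹ t^{p/2+a}(1−t)^b (1+wt/γ)^{−p/2−n/2−e−2} dt]. If b ≥ 0, e > −p/2 − n/2 − 2 and −p/2 − 1 < a < n/2 + e, then lim_{w→0⁺} φ_GB(w)/w = (p/2 + a + 1)/(γ(p/2 + a + b + 2)). -/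
open MeasureTheory Filter

/-- The complex beta integrand at real parameters is the real beta integrand. -/
lemma ofReal_rpow_mul_one_sub_rpow (s b : ℝ) {t : ℝ} (ht : t ∈ Set.Ioc (0 : ℝ) 1) :
    (t : ℂ) ^ (((s + 1 : ℝ) : ℂ) - 1) * (1 - (t : ℂ)) ^ (((b + 1 : ℝ) : ℂ) - 1) =
      ((t ^ s * (1 - t) ^ b : ℝ) : ℂ) := by
  have h : (0 : ℝ) ≤ 1 - t := sub_nonneg.2 ht.2
  rw [Complex.ofReal_mul, Complex.ofReal_cpow ht.1.le, Complex.ofReal_cpow h]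
  push_cast
  simp only [add_sub_cancel_right]

lemma intervalIntegrable_rpow_mul_one_sub_rpow {s b : ℝ} (hs : -1 < s) (hb : -1 < b) :
    IntervalIntegrable (fun t : ℝ => t ^ s * (1 - t) ^ b) volume 0 1 := by
  have h := Complex.betaIntegral_convergent (u := ((s + 1 : ℝ) : ℂ)) (v := ((b + 1 : ℝ) : ℂ))
    (by rw [Complex.ofReal_re]; linarith) (by rw [Complex.ofReal_re]; linarith)
  rw [intervalIntegrable_iff_integrableOn_Ioc_of_le zero_le_one] at h ⊢
  refine IntegrableOn.congr_fun h.re (fun t ht => ?_) measurableSet_Ioc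
  simp only [ofReal_rpow_mul_one_sub_rpow s b ht]
  exact Complex.ofReal_re _

lemma integral_rpow_mul_one_sub_rpow {s b : ℝ} (hs : -1 < s) (hb : -1 < b) :
    ∫ t in (0 : ℝ)..1, t ^ s * (1 - t) ^ b = ProbabilityTheory.beta (s + 1) (b + 1) := by
  rw [ProbabilityTheory.beta_eq_betaIntegralReal _ _ (by linarith) (by linarith),
    Complex.betaIntegral]
  have h : ∫ t in (0 : ℝ)..1,
        (t : ℂ) ^ (((s + 1 : ℝ) : ℂ) - 1) * (1 - (t : ℂ)) ^ (((b + 1 : ℝ) : ℂ) - 1) =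
      ∫ t in (0 : ℝ)..1, ((t ^ s * (1 - t) ^ b : ℝ) : ℂ) := by
    refine intervalIntegral.integral_congr_ae (Eventually.of_forall fun t ht => ?_)
    rw [Set.uIoc_of_le zero_le_one] at ht
    exact ofReal_rpow_mul_one_sub_rpow s b ht
  rw [h, intervalIntegral.integral_ofReal, Complex.ofReal_re]

lemma beta_add_one_left {x y : ℝ} (hx : 0 < x) (hy : 0 < y) :
    ProbabilityTheory.beta (x + 1) y = x / (x + y) * ProbabilityTheory.beta x y := by
  have hxy : 0 < x + y := add_pos hx hy
  have hG := (Real.Gamma_pos_of_pos hxy).ne'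
  rw [ProbabilityTheory.beta, ProbabilityTheory.beta, Real.Gamma_add_one hx.ne',
    add_right_comm, Real.Gamma_add_one hxy.ne']
  field_simp

/-- The Euler-type integral of the hypergeometric function tends to the beta function as its
argument tends to `0` from the right. -/
lemma tendsto_integral_rpow_mul_one_sub_rpow_mul {s b c γ : ℝ} (hs : -1 < s) (hb : -1 < b)
    (hc : c ≤ 0) (hγ : 0 < γ) :
    Tendsto (fun w : ℝ => ∫ t in (0 : ℝ)..1, t ^ s * (1 - t) ^ b * (1 + w * t / γ) ^ c)
      (nhdsWithin 0 (Set.Ioi 0)) (nhds (ProbabilityTheory.beta (s + 1) (b + 1))) := by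
  rw [← integral_rpow_mul_one_sub_rpow hs hb]
  refine intervalIntegral.tendsto_integral_filter_of_dominated_convergence
    (fun t => t ^ s * (1 - t) ^ b) ?_ ?_ (intervalIntegrable_rpow_mul_one_sub_rpow hs hb) ?_
  · refine Eventually.of_forall fun w => Measurable.aestronglyMeasurable ?_
    fun_prop
  · filter_upwards [self_mem_nhdsWithin] with w hw
    refine Eventually.of_forall fun t ht => ?_
    rw [Set.uIoc_of_le zero_le_one] at ht
    have hw : 0 < w := hw
    have h1 : (0 : ℝ) ≤ 1 - t := sub_nonneg.2 ht.2
    have ht0 : 0 < t := ht.1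
    have h2 : 1 ≤ 1 + w * t / γ := le_add_of_nonneg_right (by positivity)
    rw [Real.norm_of_nonneg (by positivity)]
    exact mul_le_of_le_one_right (by positivity) (Real.rpow_le_one_of_one_le_of_nonpos h2 hc)
  · refine Eventually.of_forall fun t _ => tendsto_nhdsWithin_of_tendsto_nhds ?_
    have h : ContinuousAt (fun w : ℝ => t ^ s * (1 - t) ^ b * (1 + w * t / γ) ^ c) 0 := by
      refine continuousAt_const.mul (ContinuousAt.rpow_const (by fun_prop) (Or.inl ?_))
      simp
    simpa [ContinuousAt] using h

/-- Lemma 2.2(iv): with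
`φ_GB(w) = [w ∫₀¹ t^{p/2+a+1}(1−t)^b (1+wt/γ)^{−p/2−n/2−e−2} dt]
            / [γ ∫₀¹ t^{p/2+a}(1−t)^b (1+wt/γ)^{−p/2−n/2−e−2} dt]`,
if `b ≥ 0`, `e > −p/2 − n/2 − 2` and `−p/2 − 1 < a < n/2 + e`, then
`lim_{w→0⁺} φ_GB(w)/w = (p/2 + a + 1)/(γ(p/2 + a + b + 2))`. -/
theorem stmt_4 (p n : ℕ) (hp : 0 < p) (hn : 0 < n) (a b e γ : ℝ)
    (hγ : 1 ≤ γ) (hb : 0 ≤ b) (he : -(p : ℝ) / 2 - (n : ℝ) / 2 - 2 < e)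
    (ha₁ : -(p : ℝ) / 2 - 1 < a) (ha₂ : a < (n : ℝ) / 2 + e)
    (hint : ∀ w > (0 : ℝ),
      IntervalIntegrable (fun t => t ^ ((p : ℝ) / 2 + a + 1) * (1 - t) ^ b *
        (1 + w * t / γ) ^ (-(p : ℝ) / 2 - (n : ℝ) / 2 - e - 2)) volume 0 1 ∧
      IntervalIntegrable (fun t => t ^ ((p : ℝ) / 2 + a) * (1 - t) ^ b *
        (1 + w * t / γ) ^ (-(p : ℝ) / 2 - (n : ℝ) / 2 - e - 2)) volume 0 1)
    (φGB : ℝ → ℝ)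
    (hφGB : ∀ w, φGB w =
      (w * ∫ t in (0:ℝ)..1, t ^ ((p : ℝ) / 2 + a + 1) * (1 - t) ^ b *
        (1 + w * t / γ) ^ (-(p : ℝ) / 2 - (n : ℝ) / 2 - e - 2)) /
      (γ * ∫ t in (0:ℝ)..1, t ^ ((p : ℝ) / 2 + a) * (1 - t) ^ b *
        (1 + w * t / γ) ^ (-(p : ℝ) / 2 - (n : ℝ) / 2 - e - 2))) :
    Tendsto (fun w => φGB w / w) (nhdsWithin 0 (Set.Ioi 0))
      (nhds (((p : ℝ) / 2 + a + 1) / (γ * ((p : ℝ) / 2 + a + b + 2)))) := by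
  have hγ0 : 0 < γ := by linarith
  have hs : (0 : ℝ) < (p : ℝ) / 2 + a + 1 := by linarith
  have hc : -(p : ℝ) / 2 - (n : ℝ) / 2 - e - 2 ≤ 0 := by linarith
  have hnum := tendsto_integral_rpow_mul_one_sub_rpow_mul (s := (p : ℝ) / 2 + a + 1) (b := b)
    (by linarith) (by linarith) hc hγ0
  have hden := tendsto_integral_rpow_mul_one_sub_rpow_mul (s := (p : ℝ) / 2 + a) (b := b)
    (by linarith) (by linarith) hc hγ0
  have hbeta : 0 < ProbabilityTheory.beta ((p : ℝ) / 2 + a + 1) (b + 1) :=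
    ProbabilityTheory.beta_pos hs (by linarith)
  have hlim := hnum.div (hden.const_mul γ) (mul_pos hγ0 hbeta).ne'
  rw [beta_add_one_left hs (by linarith)] at hlim
  have hval : ((p : ℝ) / 2 + a + 1) / (γ * ((p : ℝ) / 2 + a + b + 2)) =
      ((p : ℝ) / 2 + a + 1) / ((p : ℝ) / 2 + a + 1 + (b + 1)) *
        ProbabilityTheory.beta ((p : ℝ) / 2 + a + 1) (b + 1) /
        (γ * ProbabilityTheory.beta ((p : ℝ) / 2 + a + 1) (b + 1)) := by
    rw [mul_comm γ (ProbabilityTheory.beta _ _), mul_comm (_ / _), mul_div_mul_left _ _ hbeta.ne',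
      div_div, mul_comm γ]
    congr 2
    ring
  rw [hval]
  refine hlim.congr' ?_
  filter_upwards [self_mem_nhdsWithin] with w hw
  rw [Pi.div_apply, hφGB, div_right_comm, mul_div_cancel_left₀ _ (ne_of_gt hw)]
end

section
/- For real numbers α > −1, β > −1, any real γ, and any w ≥ 0, the change of variables t = (1+w)λ/(1+wλ) yields the identity ∫₀¹ λ^α (1−λ)^β (1+wλ)^{−γ} dλ = (w+1)^{−(α+1)} ∫₀¹ t^α (1−t)^β (1 − tw/(w+1))^{γ−α−β−2} dt. -/
open MeasureTheory

/-- The Möbius map `l ↦ (1 + w) l / (1 + w l)` maps the open unit interval onto itself. -/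
lemma image_moebius_Ioo {w : ℝ} (hw : 0 ≤ w) :
    (fun l : ℝ => (1 + w) * l / (1 + w * l)) '' Set.Ioo 0 1 = Set.Ioo 0 1 := by
  ext t
  constructor
  · rintro ⟨l, ⟨h0, h1⟩, rfl⟩
    have hD : 0 < 1 + w * l := by positivity
    refine ⟨by positivity, ?_⟩
    rw [div_lt_one hD]
    linarith
  · rintro ⟨h0, h1⟩
    have hD : 0 < 1 + w * (1 - t) := by nlinarith [mul_nonneg hw (sub_pos.2 h1).le]
    refine ⟨t / (1 + w * (1 - t)), ⟨by positivity, ?_⟩, ?_⟩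
    · rw [div_lt_one hD]
      nlinarith [mul_nonneg hw (sub_pos.2 h1).le]
    · have hsum : 1 + w * (t / (1 + w * (1 - t))) = (1 + w) / (1 + w * (1 - t)) := by
        field_simp
        ring
      have hw1 : 1 + w ≠ 0 := by positivity
      simp only [hsum]
      field_simp

lemma hasDerivAt_moebius {w l : ℝ} (hD : 1 + w * l ≠ 0) :
    HasDerivAt (fun l : ℝ => (1 + w) * l / (1 + w * l)) ((1 + w) / (1 + w * l) ^ 2) l := by
  have hnum := (hasDerivAt_id' l).const_mul (1 + w)
  have hden := ((hasDerivAt_id' l).const_mul w).const_add 1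
  refine (hnum.fun_div hden hD).congr_deriv ?_
  congr 1
  ring

lemma injOn_moebius {w : ℝ} (hw : 0 ≤ w) :
    Set.InjOn (fun l : ℝ => (1 + w) * l / (1 + w * l)) (Set.Ioo 0 1) := by
  rintro a ⟨ha, -⟩ b ⟨hb, -⟩ hab
  have hA : 1 + w * a ≠ 0 := by positivity
  have hB : 1 + w * b ≠ 0 := by positivity
  have hw1 : 1 + w ≠ 0 := by positivity
  have hcross := (div_eq_div_iff hA hB).1 hab
  apply mul_left_cancel₀ hw1
  linarith

/-- The pointwise identity behind the substitution `t = (1 + w) l / (1 + w l)`. -/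
lemma moebius_integrand (α β γ : ℝ) {w l : ℝ} (hw : 0 ≤ w) (h0 : 0 < l) (h1 : l < 1) :
    (1 + w) / (1 + w * l) ^ 2 * (((1 + w) * l / (1 + w * l)) ^ α *
        (1 - (1 + w) * l / (1 + w * l)) ^ β *
        (1 - (1 + w) * l / (1 + w * l) * w / (w + 1)) ^ (γ - α - β - 2))
      = (w + 1) ^ (α + 1) * (l ^ α * (1 - l) ^ β * (1 + w * l) ^ (-γ)) := by
  have hD : 0 < 1 + w * l := by positivity
  have hw1 : 0 < 1 + w := by positivity
  have hl : 0 < 1 - l := sub_pos.2 h1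
  have hone : 1 - (1 + w) * l / (1 + w * l) = (1 - l) / (1 + w * l) := by
    field_simp
    ring
  have hlast : 1 - (1 + w) * l / (1 + w * l) * w / (w + 1) = (1 + w * l)⁻¹ := by
    rw [add_comm w 1]
    field_simp
    ring
  have hpow : (1 + w * l) ^ (-γ) = ((1 + w * l) ^ α)⁻¹ * ((1 + w * l) ^ β)⁻¹ *
      ((1 + w * l) ^ (γ - α - β - 2))⁻¹ * ((1 + w * l) ^ 2)⁻¹ := by
    rw [← Real.rpow_natCast (1 + w * l) 2]
    simp only [← Real.rpow_neg hD.le, ← Real.rpow_add hD]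
    congr 1
    push_cast
    ring
  rw [hone, hlast, Real.div_rpow (by positivity) hD.le, Real.div_rpow hl.le hD.le,
    Real.inv_rpow hD.le, Real.mul_rpow hw1.le h0.le, hpow, add_comm w 1,
    Real.rpow_add_one hw1.ne']
  simp only [div_eq_mul_inv]
  ring

/-- Change-of-variables identity (paper, Section 2): for `α, β > -1`, any real `γ`
and any `w ≥ 0`,
`∫₀¹ λ^α (1-λ)^β (1+wλ)^{-γ} dλ
  = (w+1)^{-(α+1)} ∫₀¹ t^α (1-t)^β (1 - tw/(w+1))^{γ-α-β-2} dt`. -/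
theorem stmt_5 (α β γ w : ℝ) (hα : -1 < α) (hβ : -1 < β) (hw : 0 ≤ w) :
    ∫ l in (0:ℝ)..1, l ^ α * (1 - l) ^ β * (1 + w * l) ^ (-γ)
      = (w + 1) ^ (-(α + 1)) *
        ∫ t in (0:ℝ)..1, t ^ α * (1 - t) ^ β * (1 - t * w / (w + 1)) ^ (γ - α - β - 2) := by
  have hw1 : 0 < w + 1 := by positivity
  have hsubst := integral_image_eq_integral_abs_deriv_smul (s := Set.Ioo (0:ℝ) 1)
    measurableSet_Ioo
    (fun l hl => (hasDerivAt_moebius (w := w)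
      (by have := hl.1; positivity : 1 + w * l ≠ 0)).hasDerivWithinAt)
    (injOn_moebius hw)
    (fun t : ℝ => t ^ α * (1 - t) ^ β * (1 - t * w / (w + 1)) ^ (γ - α - β - 2))
  rw [image_moebius_Ioo hw] at hsubst
  have hcongr : Set.EqOn
      (fun l : ℝ => |(1 + w) / (1 + w * l) ^ 2| • (((1 + w) * l / (1 + w * l)) ^ α *
        (1 - (1 + w) * l / (1 + w * l)) ^ β *
        (1 - (1 + w) * l / (1 + w * l) * w / (w + 1)) ^ (γ - α - β - 2)))
      (fun l : ℝ => (w + 1) ^ (α + 1) * (l ^ α * (1 - l) ^ β * (1 + w * l) ^ (-γ)))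
      (Set.Ioo 0 1) := by
    intro l hl
    have habs : |(1 + w) / (1 + w * l) ^ 2| = (1 + w) / (1 + w * l) ^ 2 :=
      abs_of_nonneg (by positivity)
    simp only [smul_eq_mul, habs]
    exact moebius_integrand α β γ hw hl.1 hl.2
  simp only [intervalIntegral.integral_of_le zero_le_one, integral_Ioc_eq_integral_Ioo]
  rw [hsubst, setIntegral_congr_fun measurableSet_Ioo hcongr, integral_const_mul, ← mul_assoc,
    ← Real.rpow_add hw1, neg_add_cancel, Real.rpow_zero, one_mul]
end

section
/- Let φ_GB(w) = [w ∫₀¹ t^{p/2+a+1}(1−t)^b (1+wt/γ)^{−p/2−n/2−e−2} dt] / [γ ∫₀¹ t^{p/2+a}(1−t)^b (1+wt/γ)^{−p/2−n/2−e−2} dt]. If the parameters satisfy b = n/2 − a + e − 1 (together with b > −1 and a > −p/2 − 1), then for every w > 0, φ_GB(w) = αw/(γ(α+1) + w), where α = (p/2 + a + 1)/(b + 1) = (p/2 + a + 1)/(n/2 + e − a). -/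
open MeasureTheory

/-- The derivative of `t ^ u * (1 - t) ^ v * (1 + c * t) ^ (-(u + v))` on `(0, 1)`. -/
theorem hasDerivAt_rpow_mul_one_sub_rpow_mul {u v c t : ℝ} (hc : 0 < c)
    (ht : t ∈ Set.Ioo (0 : ℝ) 1) :
    HasDerivAt (fun t : ℝ => t ^ u * (1 - t) ^ v * (1 + c * t) ^ (-(u + v)))
      (u * (t ^ (u - 1) * (1 - t) ^ (v - 1) * (1 + c * t) ^ (-(u + v) - 1)) -
        (u + v + v * c) * (t ^ u * (1 - t) ^ (v - 1) * (1 + c * t) ^ (-(u + v) - 1))) t := by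
  obtain ⟨h0, h1⟩ := ht
  have h1' : 0 < 1 - t := by linarith
  have h2 : 0 < 1 + c * t := by positivity
  have d1 := Real.hasDerivAt_rpow_const (x := t) (p := u) (Or.inl h0.ne')
  have d2 := ((hasDerivAt_id t).const_sub 1).rpow_const (p := v) (Or.inl h1'.ne')
  have d3 := (((hasDerivAt_id t).const_mul c).const_add 1).rpow_const (p := -(u + v))
    (Or.inl h2.ne')
  refine ((d1.mul d2).mul d3).congr_deriv ?_
  have e1 : t ^ u = t ^ (u - 1) * t := by
    rw [Real.rpow_sub_one h0.ne', div_mul_cancel₀ _ h0.ne']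
  have e2 : (1 - t) ^ v = (1 - t) ^ (v - 1) * (1 - t) := by
    rw [Real.rpow_sub_one h1'.ne', div_mul_cancel₀ _ h1'.ne']
  have e3 : (1 + c * t) ^ (-(u + v)) = (1 + c * t) ^ (-(u + v) - 1) * (1 + c * t) := by
    rw [Real.rpow_sub_one h2.ne', div_mul_cancel₀ _ h2.ne']
  simp only [id, Pi.mul_apply]
  rw [e1, e2, e3]
  ring

/-- A contiguity relation for Euler-type integrals, from integrating the derivative of
`t ^ u * (1 - t) ^ v * (1 + c * t) ^ (-(u + v))` over `[0, 1]`. -/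
theorem mul_integral_rpow_mul_one_sub_rpow_mul_eq {u v c : ℝ} (hu : 0 < u) (hv : 0 < v)
    (hc : 0 < c)
    (hf : IntervalIntegrable
      (fun t : ℝ => t ^ u * (1 - t) ^ (v - 1) * (1 + c * t) ^ (-(u + v) - 1)) volume 0 1)
    (hg : IntervalIntegrable
      (fun t : ℝ => t ^ (u - 1) * (1 - t) ^ (v - 1) * (1 + c * t) ^ (-(u + v) - 1)) volume 0 1) :
    u * ∫ t in (0 : ℝ)..1, t ^ (u - 1) * (1 - t) ^ (v - 1) * (1 + c * t) ^ (-(u + v) - 1) =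
      (u + v + v * c) *
        ∫ t in (0 : ℝ)..1, t ^ u * (1 - t) ^ (v - 1) * (1 + c * t) ^ (-(u + v) - 1) := by
  have hcont : ContinuousOn (fun t : ℝ => t ^ u * (1 - t) ^ v * (1 + c * t) ^ (-(u + v)))
      (Set.Icc 0 1) := by
    refine ((continuousOn_id.rpow_const fun _ _ => Or.inr hu.le).mul
      (ContinuousOn.rpow_const (by fun_prop) fun _ _ => Or.inr hv.le)).mul
      (ContinuousOn.rpow_const (by fun_prop) fun t ht => Or.inl ?_)
    have := mul_nonneg hc.le ht.1
    positivity
  have key := intervalIntegral.integral_eq_sub_of_hasDerivAt_of_le zero_le_one hcont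
    (fun t ht => hasDerivAt_rpow_mul_one_sub_rpow_mul hc ht)
    ((hg.const_mul u).sub (hf.const_mul (u + v + v * c)))
  rw [intervalIntegral.integral_sub (hg.const_mul u) (hf.const_mul _),
    intervalIntegral.integral_const_mul, intervalIntegral.integral_const_mul] at key
  simp only [sub_self, Real.zero_rpow hu.ne', Real.zero_rpow hv.ne', mul_zero, zero_mul] at key
  linarith

/-- Section 2.1: when `b = n/2 − a + e − 1` (with `b > −1`, `a > −p/2 − 1`), the
generalized Bayes shrinkage function takes the simple form
`φ_GB(w) = αw/(γ(α+1) + w)` with `α = (p/2 + a + 1)/(b + 1) = (p/2 + a + 1)/(n/2 + e − a)`. -/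
theorem stmt_6 (p n : ℕ) (hp : 0 < p) (hn : 0 < n) (a b e γ : ℝ)
    (hγ : 1 ≤ γ) (hb : -1 < b) (ha : -(p : ℝ) / 2 - 1 < a)
    (hbe : b = (n : ℝ) / 2 - a + e - 1)
    (hint : ∀ w > (0 : ℝ),
      IntervalIntegrable (fun t => t ^ ((p : ℝ) / 2 + a + 1) * (1 - t) ^ b *
        (1 + w * t / γ) ^ (-(p : ℝ) / 2 - (n : ℝ) / 2 - e - 2)) volume 0 1 ∧
      IntervalIntegrable (fun t => t ^ ((p : ℝ) / 2 + a) * (1 - t) ^ b *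
        (1 + w * t / γ) ^ (-(p : ℝ) / 2 - (n : ℝ) / 2 - e - 2)) volume 0 1)
    (φGB : ℝ → ℝ)
    (hφGB : ∀ w, φGB w =
      (w * ∫ t in (0:ℝ)..1, t ^ ((p : ℝ) / 2 + a + 1) * (1 - t) ^ b *
        (1 + w * t / γ) ^ (-(p : ℝ) / 2 - (n : ℝ) / 2 - e - 2)) /
      (γ * ∫ t in (0:ℝ)..1, t ^ ((p : ℝ) / 2 + a) * (1 - t) ^ b *
        (1 + w * t / γ) ^ (-(p : ℝ) / 2 - (n : ℝ) / 2 - e - 2))) :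
    (((p : ℝ) / 2 + a + 1) / (b + 1) = ((p : ℝ) / 2 + a + 1) / ((n : ℝ) / 2 + e - a)) ∧
      ∀ w > (0 : ℝ), φGB w =
        (((p : ℝ) / 2 + a + 1) / (b + 1)) * w /
          (γ * (((p : ℝ) / 2 + a + 1) / (b + 1) + 1) + w) := by
  have hu : 0 < (p : ℝ) / 2 + a + 1 := by linarith
  have hv : 0 < b + 1 := by linarith
  refine ⟨by rw [hbe]; congr 1; ring, fun w hw => ?_⟩
  have hγ0 : 0 < γ := by linarith
  have hc : 0 < w / γ := by positivity
  obtain ⟨hf, hg⟩ := hint w hw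
  rw [hφGB w]
  have hexp : -(p : ℝ) / 2 - (n : ℝ) / 2 - e - 2 =
      -(((p : ℝ) / 2 + a + 1) + (b + 1)) - 1 := by rw [hbe]; ring
  simp only [hexp, mul_div_right_comm w _ γ] at hf hg ⊢
  have hpos : 0 < ∫ t in (0 : ℝ)..1, t ^ ((p : ℝ) / 2 + a) * (1 - t) ^ b *
      (1 + w / γ * t) ^ (-(((p : ℝ) / 2 + a + 1) + (b + 1)) - 1) := by
    refine intervalIntegral.intervalIntegral_pos_of_pos_on hg (fun t ht => ?_) zero_lt_one
    have h0 := ht.1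
    have h1 : 0 < 1 - t := by linarith [ht.2]
    positivity
  have key := mul_integral_rpow_mul_one_sub_rpow_mul_eq hu hv hc
    (by simpa only [add_sub_cancel_right] using hf)
    (by simpa only [add_sub_cancel_right] using hg)
  simp only [add_sub_cancel_right] at key
  generalize (∫ t in (0 : ℝ)..1, t ^ ((p : ℝ) / 2 + a) * (1 - t) ^ b *
      (1 + w / γ * t) ^ (-(((p : ℝ) / 2 + a + 1) + (b + 1)) - 1)) = D at key hpos ⊢
  generalize (∫ t in (0 : ℝ)..1, t ^ ((p : ℝ) / 2 + a + 1) * (1 - t) ^ b *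
      (1 + w / γ * t) ^ (-(((p : ℝ) / 2 + a + 1) + (b + 1)) - 1)) = N at key ⊢
  generalize (p : ℝ) / 2 + a + 1 = u at hu key ⊢
  generalize b + 1 = v at hv key ⊢
  have hden : 0 < γ * (u / v + 1) + w := by positivity
  rw [div_eq_div_iff (by positivity) hden.ne']
  field_simp at key ⊢
  linear_combination -key
end
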